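/- arXiv:2501.11125 — 3 statements merged into one kernel-verified Lean document; each statement's English description precedes it below -/
import Mathlib

section
/- Let p be an odd prime, K a field of characteristic p, and G = Z/pZ. Then V_0 ⊗ V_1 ≅ V_1; for 0 < d < p−1, V_d ⊗ V_1 ≅ V_{d+1} ⊕ V_{d−1}; and V_{p−1} ⊗ V_1 ≅ V_{p−1} ⊕ V_{p−1}. -/
open CategoryTheory MonoidalCategory Limits

noncomputable section

universe u

/-- A submodule is a subrepresentation if it is stable under the group action. -/
def IsSubrep {k G V : Type u} [Field k] [Monoid G] [AddCommGroup V] [Module k V]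
    (ρ : Representation k G V) (U : Submodule k V) : Prop :=
  ∀ g : G, ∀ v ∈ U, ρ g v ∈ U

/-- A representation is irreducible if it is nonzero and its only subrepresentations
are `⊥` and `⊤`. -/
def IsIrreducibleRep {k G V : Type u} [Field k] [Monoid G] [AddCommGroup V] [Module k V]
    (ρ : Representation k G V) : Prop :=
  (∃ v : V, v ≠ 0) ∧ ∀ U : Submodule k V, IsSubrep ρ U → U = ⊥ ∨ U = ⊤

/-- A representation is indecomposable if it is nonzero and is not the direct sum of two
nonzero subrepresentations. -/
def IsIndecomposableRep {k G V : Type u} [Field k] [Monoid G] [AddCommGroup V] [Module k V]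
    (ρ : Representation k G V) : Prop :=
  (∃ v : V, v ≠ 0) ∧
    ∀ U U' : Submodule k V, IsSubrep ρ U → IsSubrep ρ U' → IsCompl U U' → U = ⊥ ∨ U' = ⊥

/-- An object of `Rep k G` is indecomposable. -/
def RepIndecomposable {k G : Type u} [Field k] [Monoid G] (W : Rep k G) : Prop :=
  IsIndecomposableRep W.ρ

section NilpotentEndomorphisms

open Module

variable {k V W : Type*} [Field k] [AddCommGroup V] [Module k V] [AddCommGroup W] [Module k W]

theorem Module.End.pow_apply_eq_zero_of_le {N : End k V} {v : V} {m j : ℕ}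
    (h : (N ^ m) v = 0) (hj : m ≤ j) : (N ^ j) v = 0 := by
  obtain ⟨i, rfl⟩ := Nat.exists_eq_add_of_le' hj
  rw [pow_add, End.mul_apply, h, map_zero]

theorem Module.End.coeff_eq_zero_of_pairing {N : End k V} {v : V} {m : ℕ} {f : Dual k V}
    (hf : f ((N ^ m) v) ≠ 0) (hv : (N ^ (m + 1)) v = 0) {c : Fin (m + 1) → k}
    (hc : ∀ j, f ((N ^ j) (∑ i, c i • (N ^ (i : ℕ)) v)) = 0) : c = 0 := by
  suffices h : ∀ n : ℕ, ∀ i : Fin (m + 1), (i : ℕ) = n → c i = 0 from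
    funext fun i ↦ h i i rfl
  intro n
  induction n using Nat.strong_induction_on with
  | _ n ih =>
    rintro i rfl
    have key := hc (m - i)
    rw [map_sum, map_sum, Finset.sum_eq_single i] at key
    · rw [map_smul, ← End.mul_apply, ← pow_add, Nat.sub_add_cancel (by omega), map_smul,
        smul_eq_mul] at key
      exact (mul_eq_zero.mp key).resolve_right hf
    · intro j _ hj
      rcases lt_or_gt_of_ne (Fin.val_ne_of_ne hj) with h | h
      · simp [ih j h j rfl]
      · rw [map_smul, ← End.mul_apply, ← pow_add,
          End.pow_apply_eq_zero_of_le hv (by omega), smul_zero, map_zero]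
    · simp

theorem Module.End.linearIndependent_pow_apply {N : End k V} {v : V} {m : ℕ}
    (hv : (N ^ m) v ≠ 0) (hv' : (N ^ (m + 1)) v = 0) :
    LinearIndependent k (fun i : Fin (m + 1) ↦ (N ^ (i : ℕ)) v) := by
  obtain ⟨f, hf⟩ := Projective.exists_dual_ne_zero k hv
  rw [Fintype.linearIndependent_iff]
  intro c hc
  exact congrFun (End.coeff_eq_zero_of_pairing hf hv' fun j ↦ by simp [hc])

/-- The vector `v` generates `V` as a single Jordan block of size `m + 1` for `N`. -/
structure IsJordanGenerator (N : End k V) (m : ℕ) (v : V) : Prop where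
  pow_ne_zero : (N ^ m) v ≠ 0
  pow_succ_eq_zero : (N ^ (m + 1)) v = 0
  finrank_eq : finrank k V = m + 1

namespace IsJordanGenerator

variable {N : End k V} {M : End k W} {m : ℕ} {v : V}

/-- The Jordan basis attached to a generator. -/
def basis (h : IsJordanGenerator N m v) : Basis (Fin (m + 1)) k V :=
  basisOfLinearIndependentOfCardEqFinrank
    (End.linearIndependent_pow_apply h.pow_ne_zero h.pow_succ_eq_zero) (by simp [h.finrank_eq])

@[simp]
theorem basis_apply (h : IsJordanGenerator N m v) (i : Fin (m + 1)) :
    h.basis i = (N ^ (i : ℕ)) v := by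
  simp [basis]

theorem exists_smul_of_apply_eq_zero (h : IsJordanGenerator N m v) {x : V} (hx : N x = 0) :
    ∃ c : k, x = c • (N ^ m) v := by
  have hcoord (i : Fin m) : h.basis.coord i.succ ∘ₗ N = h.basis.coord i.castSucc := by
    refine h.basis.ext fun j ↦ ?_
    induction j using Fin.lastCases with
    | last =>
      have h0 : N (h.basis (Fin.last m)) = 0 := by
        rw [basis_apply, ← End.mul_apply, ← pow_succ']
        exact h.pow_succ_eq_zero
      rw [LinearMap.comp_apply, h0, map_zero, Basis.coord_apply, Basis.repr_self,
        Finsupp.single_eq_of_ne (Fin.castSucc_lt_last i).ne]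
    | cast j =>
      have h1 : N (h.basis j.castSucc) = h.basis j.succ := by
        rw [basis_apply, basis_apply, ← End.mul_apply, ← pow_succ']
        rfl
      rw [LinearMap.comp_apply, h1, Basis.coord_apply, Basis.coord_apply, Basis.repr_self,
        Basis.repr_self, Finsupp.single_apply, Finsupp.single_apply]
      simp
  refine ⟨h.basis.repr x (Fin.last m), ?_⟩
  conv_lhs => rw [← h.basis.sum_repr x, Fin.sum_univ_castSucc]
  rw [Finset.sum_eq_zero, zero_add, basis_apply, Fin.val_last]
  intro i _
  rw [← Basis.coord_apply, ← hcoord i, LinearMap.comp_apply, hx, map_zero, zero_smul]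

/-- The linear map sending the generator to `u` and intertwining `N` with `M`. -/
def lift (h : IsJordanGenerator N m v) (M : End k W) (u : W) : V →ₗ[k] W :=
  h.basis.constr k fun i ↦ (M ^ (i : ℕ)) u

theorem lift_pow_apply (h : IsJordanGenerator N m v) {u : W} (hu : (M ^ (m + 1)) u = 0) (j : ℕ) :
    h.lift M u ((N ^ j) v) = (M ^ j) u := by
  rcases lt_or_ge j (m + 1) with hj | hj
  · have := h.basis.constr_basis k (fun i ↦ (M ^ (i : ℕ)) u) ⟨j, hj⟩
    rwa [basis_apply] at this
  · rw [End.pow_apply_eq_zero_of_le h.pow_succ_eq_zero hj, End.pow_apply_eq_zero_of_le hu hj,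
      map_zero]

theorem lift_apply_apply (h : IsJordanGenerator N m v) {u : W} (hu : (M ^ (m + 1)) u = 0)
    (x : V) : h.lift M u (N x) = M (h.lift M u x) := by
  suffices h.lift M u ∘ₗ N = M ∘ₗ h.lift M u from LinearMap.congr_fun this x
  refine h.basis.ext fun i ↦ ?_
  rw [LinearMap.comp_apply, LinearMap.comp_apply, basis_apply, h.lift_pow_apply hu,
    ← End.mul_apply, ← pow_succ', h.lift_pow_apply hu, pow_succ', End.mul_apply]

theorem pow_succ_apply_eq_zero (h : IsJordanGenerator N m v) (x : V) : (N ^ (m + 1)) x = 0 := by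
  suffices N ^ (m + 1) = 0 by simp [this]
  refine h.basis.ext fun i ↦ ?_
  rw [basis_apply, ← End.mul_apply, ← pow_add, LinearMap.zero_apply]
  exact End.pow_apply_eq_zero_of_le h.pow_succ_eq_zero (by omega)

end IsJordanGenerator

theorem LinearMap.prodMap_pow_apply {V' : Type*} [AddCommGroup V'] [Module k V'] (N : End k V)
    (N' : End k V') (n : ℕ) (x : V × V') :
    ((N.prodMap N' : End k (V × V')) ^ n) x = ((N ^ n) x.1, (N' ^ n) x.2) := by
  induction n with
  | zero => rfl
  | succ n ih => simp only [pow_succ', End.mul_apply, ih, LinearMap.prodMap_apply]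

theorem Module.End.exists_pow_apply_ne_zero {N : End k V} {x : V} {m : ℕ} (hx : x ≠ 0)
    (hm : (N ^ m) x = 0) : ∃ j, (N ^ j) x ≠ 0 ∧ N ((N ^ j) x) = 0 := by
  induction m with
  | zero => exact absurd hm hx
  | succ m ih =>
    by_cases h : (N ^ m) x = 0
    · exact ih h
    · exact ⟨m, h, by rwa [← End.mul_apply, ← pow_succ']⟩

theorem Module.End.injective_of_intertwining {N : End k V} {M : End k W} (φ : V →ₗ[k] W) {m : ℕ}
    (hN : ∀ x, (N ^ m) x = 0) (hφ : ∀ x, φ (N x) = M (φ x))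
    (hker : ∀ x, N x = 0 → φ x = 0 → x = 0) : Function.Injective φ := by
  rw [injective_iff_map_eq_zero]
  intro x hx
  by_contra hne
  obtain ⟨j, hj, hj'⟩ := End.exists_pow_apply_ne_zero hne (hN x)
  refine hj (hker _ hj' ?_)
  clear hj hj'
  induction j with
  | zero => simpa using hx
  | succ j ih => rw [pow_succ', End.mul_apply, hφ, ih, map_zero]

theorem IsJordanGenerator.bijective_lift {N : End k V} {M : End k W} {m : ℕ} {v : V}
    (h : IsJordanGenerator N m v) {u : W} (hu : (M ^ (m + 1)) u = 0) (hu' : (M ^ m) u ≠ 0)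
    (hW : finrank k W = m + 1) : Function.Bijective (h.lift M u) := by
  have : FiniteDimensional k V := .of_finrank_pos (by rw [h.finrank_eq]; omega)
  have : FiniteDimensional k W := .of_finrank_pos (by omega)
  have inj : Function.Injective (h.lift M u) := by
    refine End.injective_of_intertwining _ h.pow_succ_apply_eq_zero (h.lift_apply_apply hu) ?_
    intro x hx hx'
    obtain ⟨c, rfl⟩ := h.exists_smul_of_apply_eq_zero hx
    rw [map_smul, h.lift_pow_apply hu] at hx'
    rw [(smul_eq_zero.mp hx').resolve_right hu', zero_smul]
  exact ⟨inj, (LinearMap.injective_iff_surjective_of_finrank_eq_finrank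
    (h.finrank_eq.trans hW.symm)).mp inj⟩

theorem IsJordanGenerator.bijective_coprod_lift {V' : Type*} [AddCommGroup V'] [Module k V']
    {N : End k V} {N' : End k V'} {M : End k W} {m m' : ℕ} {v : V} {v' : V'}
    (h : IsJordanGenerator N m v) (h' : IsJordanGenerator N' m' v') {u u' : W}
    (hu : (M ^ (m + 1)) u = 0) (hu' : (M ^ (m' + 1)) u' = 0)
    (hli : ∀ a b : k, a • (M ^ m) u + b • (M ^ m') u' = 0 → a = 0 ∧ b = 0)
    (hW : finrank k W = (m + 1) + (m' + 1)) :
    Function.Bijective ((h.lift M u).coprod (h'.lift M u')) := by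
  have : FiniteDimensional k V := .of_finrank_pos (by rw [h.finrank_eq]; omega)
  have : FiniteDimensional k V' := .of_finrank_pos (by rw [h'.finrank_eq]; omega)
  have : FiniteDimensional k W := .of_finrank_pos (by omega)
  have inj : Function.Injective ((h.lift M u).coprod (h'.lift M u')) := by
    refine End.injective_of_intertwining (N := N.prodMap N') (M := M) _
      (m := (m + 1) + (m' + 1)) ?_ ?_ ?_
    · intro x
      rw [LinearMap.prodMap_pow_apply,
        End.pow_apply_eq_zero_of_le (h.pow_succ_apply_eq_zero _) (by omega),
        End.pow_apply_eq_zero_of_le (h'.pow_succ_apply_eq_zero _) (by omega), Prod.mk_zero_zero]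
    · intro x
      simp [h.lift_apply_apply hu, h'.lift_apply_apply hu']
    · rintro ⟨x, x'⟩ hx hx'
      rw [LinearMap.prodMap_apply, Prod.mk_eq_zero] at hx
      obtain ⟨a, rfl⟩ := h.exists_smul_of_apply_eq_zero hx.1
      obtain ⟨b, rfl⟩ := h'.exists_smul_of_apply_eq_zero hx.2
      rw [LinearMap.coprod_apply, map_smul, map_smul, h.lift_pow_apply hu,
        h'.lift_pow_apply hu'] at hx'
      obtain ⟨rfl, rfl⟩ := hli a b hx'
      simp
  refine ⟨inj, (LinearMap.injective_iff_surjective_of_finrank_eq_finrank ?_).mp inj⟩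
  rw [finrank_prod, h.finrank_eq, h'.finrank_eq, hW]

/-- A vector of maximal height under a nilpotent endomorphism spans a cyclic subspace which has
an invariant complement. -/
theorem Module.End.exists_isCompl_span_pow [FiniteDimensional k V] {N : End k V} {m : ℕ} {v : V}
    (hv : (N ^ m) v ≠ 0) (hN : N ^ (m + 1) = 0) :
    ∃ U : Submodule k V, (∀ x ∈ U, N x ∈ U) ∧
      IsCompl (Submodule.span k (Set.range fun i : Fin (m + 1) ↦ (N ^ (i : ℕ)) v)) U := by
  obtain ⟨f, hf⟩ := Projective.exists_dual_ne_zero k hv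
  have hv' : (N ^ (m + 1)) v = 0 := by simp [hN]
  let Φ : V →ₗ[k] Fin (m + 1) → k := LinearMap.pi fun i ↦ f ∘ₗ (N ^ (i : ℕ))
  have hΦ {x : V} (hx : x ∈ LinearMap.ker Φ) (j : ℕ) : f ((N ^ j) x) = 0 := by
    rcases lt_or_ge j (m + 1) with hj | hj
    · exact congrFun (LinearMap.mem_ker.mp hx) ⟨j, hj⟩
    · rw [pow_eq_zero_of_le hj hN, LinearMap.zero_apply, map_zero]
  refine ⟨LinearMap.ker Φ, fun x hx ↦ ?_, (Submodule.isCompl_iff_disjoint _ _ ?_).mpr ?_⟩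
  · refine LinearMap.mem_ker.mpr (funext fun i ↦ ?_)
    change f ((N ^ (i : ℕ)) (N x)) = 0
    rw [← End.mul_apply, ← pow_succ]
    exact hΦ hx _
  · rw [finrank_span_eq_card (End.linearIndependent_pow_apply hv hv'), Fintype.card_fin,
      ← LinearMap.finrank_range_add_finrank_ker Φ]
    have := (LinearMap.range Φ).finrank_le
    rw [finrank_fin_fun] at this
    omega
  · rw [Submodule.disjoint_def]
    intro x hx hx'
    obtain ⟨c, rfl⟩ := (Submodule.mem_span_range_iff_exists_fun k).mp hx
    rw [End.coeff_eq_zero_of_pairing hf hv' (hΦ hx')]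
    simp

end NilpotentEndomorphisms

section CyclicGroupRepresentations

open Module

variable {k : Type} [Field k] {p : ℕ}

/-- The operator `g - 1` for the standard generator `g` of `ℤ/pℤ`. -/
def generatorSubOne (A : Rep k (Multiplicative (ZMod p))) : End k A.V :=
  A.ρ (Multiplicative.ofAdd 1) - 1

theorem rho_ofAdd_one_apply (A : Rep k (Multiplicative (ZMod p))) (x : A.V) :
    A.ρ (Multiplicative.ofAdd 1) x = x + generatorSubOne A x := by
  simp [generatorSubOne]

theorem rho_eq_pow [NeZero p] (A : Rep k (Multiplicative (ZMod p)))
    (g : Multiplicative (ZMod p)) :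
    A.ρ g = A.ρ (Multiplicative.ofAdd 1) ^ (Multiplicative.toAdd g).val := by
  rw [← map_pow, ← ofAdd_nsmul, nsmul_one, ZMod.natCast_zmod_val, ofAdd_toAdd]

theorem isSubrep_of_generatorSubOne [NeZero p] {A : Rep k (Multiplicative (ZMod p))}
    {U : Submodule k A.V} (hU : ∀ x ∈ U, generatorSubOne A x ∈ U) : IsSubrep A.ρ U := by
  intro g x hx
  rw [rho_eq_pow]
  induction (Multiplicative.toAdd g).val with
  | zero => simpa using hx
  | succ n ih =>
    rw [pow_succ', End.mul_apply, rho_ofAdd_one_apply]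
    exact U.add_mem ih (hU _ ih)

/-- A linear map commuting with `g - 1` is a morphism of representations. -/
def repHomOfGeneratorSubOne [NeZero p] {A B : Rep k (Multiplicative (ZMod p))} (φ : A.V →ₗ[k] B.V)
    (hφ : ∀ x, φ (generatorSubOne A x) = generatorSubOne B (φ x)) : A ⟶ B :=
  Rep.ofHom (φ.intertwiningMap_of_isIntertwiningMap A.ρ B.ρ fun g x ↦ by
    rw [rho_eq_pow A, rho_eq_pow B]
    induction (Multiplicative.toAdd g).val with
    | zero => simp
    | succ n ih =>
      rw [pow_succ', pow_succ', End.mul_apply, End.mul_apply, rho_ofAdd_one_apply,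
        rho_ofAdd_one_apply, map_add, hφ, ih])

theorem generatorSubOne_pow_char [Fact p.Prime] [CharP k p]
    (A : Rep k (Multiplicative (ZMod p))) : generatorSubOne A ^ p = 0 := by
  rcases subsingleton_or_nontrivial A.V with h | h
  · exact Subsingleton.elim _ _
  · have : CharP (End k A.V) p := charP_of_injective_algebraMap (algebraMap k _).injective p
    rw [generatorSubOne, sub_pow_char_of_commute _ (Commute.one_right _), one_pow, ← map_pow,
      ← ofAdd_nsmul]
    simp

theorem RepIndecomposable.exists_isJordanGenerator [Fact p.Prime] [CharP k p]
    {A : Rep k (Multiplicative (ZMod p))} (hA : RepIndecomposable A) {n : ℕ}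
    (hn : finrank k A.V = n + 1) : ∃ v, IsJordanGenerator (generatorSubOne A) n v := by
  have : FiniteDimensional k A.V := .of_finrank_pos (by omega)
  have : Nontrivial A.V := nontrivial_of_finrank_pos (R := k) (by omega)
  set N := generatorSubOne A with hNdef
  have hnil : IsNilpotent N := ⟨p, generatorSubOne_pow_char A⟩
  obtain ⟨m, hm⟩ : ∃ m, nilpotencyClass N = m + 1 :=
    Nat.exists_eq_succ_of_ne_zero (pos_nilpotencyClass_iff.mpr hnil).ne'
  obtain ⟨hN, hN'⟩ := nilpotencyClass_eq_succ_iff.mp hm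
  obtain ⟨v, hv⟩ : ∃ v, (N ^ m) v ≠ 0 := by
    by_contra! h
    exact hN' (LinearMap.ext h)
  have hv' : (N ^ (m + 1)) v = 0 := by simp [hN]
  obtain ⟨U, hU, hcompl⟩ := End.exists_isCompl_span_pow hv hN
  set S := Submodule.span k (Set.range fun i : Fin (m + 1) ↦ (N ^ (i : ℕ)) v) with hS
  have hmem (j : ℕ) : (N ^ j) v ∈ S := by
    rcases lt_or_ge j (m + 1) with hj | hj
    · exact Submodule.subset_span ⟨⟨j, hj⟩, rfl⟩
    · rw [End.pow_apply_eq_zero_of_le hv' hj]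
      exact S.zero_mem
  have hSN : ∀ x ∈ S, N x ∈ S := by
    change S ≤ S.comap N
    rw [hS, Submodule.span_le]
    rintro _ ⟨i, rfl⟩
    simpa [pow_succ'] using hmem (i + 1)
  rcases hA.2 S U (isSubrep_of_generatorSubOne hSN) (isSubrep_of_generatorSubOne hU) hcompl with
    h | h
  · exact absurd ((Submodule.mem_bot k).mp (h ▸ hmem m)) hv
  · have htop : S = ⊤ := by simpa [h] using hcompl.sup_eq_top
    have hcard : finrank k S = m + 1 := by
      rw [hS, finrank_span_eq_card (End.linearIndependent_pow_apply hv hv'), Fintype.card_fin]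
    rw [htop, finrank_top, hn] at hcard
    obtain rfl : n = m := by omega
    exact ⟨v, hv, hv', hn⟩

theorem nonempty_iso_of_isJordanGenerator [NeZero p] {A B : Rep k (Multiplicative (ZMod p))}
    {m : ℕ} {v : A.V} (h : IsJordanGenerator (generatorSubOne A) m v) {u : B.V}
    (hu : (generatorSubOne B ^ (m + 1)) u = 0) (hu' : (generatorSubOne B ^ m) u ≠ 0)
    (hB : finrank k B.V = m + 1) : Nonempty (B ≅ A) := by
  have hbij := h.bijective_lift hu hu' hB
  let φ : A ⟶ B := repHomOfGeneratorSubOne _ (h.lift_apply_apply hu)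
  have : Mono φ := (Rep.mono_iff_injective φ).mpr hbij.1
  have : Epi φ := (Rep.epi_iff_surjective φ).mpr hbij.2
  have : IsIso φ := isIso_of_mono_of_epi φ
  exact ⟨(asIso φ).symm⟩

theorem nonempty_iso_biprod_of_isJordanGenerator [NeZero p]
    {A A' B : Rep k (Multiplicative (ZMod p))} {m m' : ℕ} {v : A.V} {v' : A'.V}
    (h : IsJordanGenerator (generatorSubOne A) m v)
    (h' : IsJordanGenerator (generatorSubOne A') m' v') {u u' : B.V}
    (hu : (generatorSubOne B ^ (m + 1)) u = 0) (hu' : (generatorSubOne B ^ (m' + 1)) u' = 0)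
    (hli : ∀ a b : k, a • (generatorSubOne B ^ m) u + b • (generatorSubOne B ^ m') u' = 0 →
      a = 0 ∧ b = 0)
    (hB : finrank k B.V = (m + 1) + (m' + 1)) : Nonempty (B ≅ A ⊞ A') := by
  have hbij := h.bijective_coprod_lift h' hu hu' hli hB
  let φ : A ⟶ B := repHomOfGeneratorSubOne _ (h.lift_apply_apply hu)
  let ψ : A' ⟶ B := repHomOfGeneratorSubOne _ (h'.lift_apply_apply hu')
  let θ : A ⊞ A' ⟶ B := biprod.desc φ ψ
  have hθ (x : A.V) (x' : A'.V) :
      θ.hom ((biprod.inl : A ⟶ A ⊞ A').hom x + (biprod.inr : A' ⟶ A ⊞ A').hom x') =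
        (h.lift (generatorSubOne B) u).coprod (h'.lift (generatorSubOne B) u') (x, x') := by
    have h1 : θ.hom ((biprod.inl : A ⟶ A ⊞ A').hom x) = φ.hom x := by
      rw [← biprod.inl_desc φ ψ]; rfl
    have h2 : θ.hom ((biprod.inr : A' ⟶ A ⊞ A').hom x') = ψ.hom x' := by
      rw [← biprod.inr_desc φ ψ]; rfl
    rw [map_add, h1, h2]
    rfl
  have htotal (z : (A ⊞ A' : Rep k (Multiplicative (ZMod p))).V) :
      z = (biprod.inl : A ⟶ A ⊞ A').hom ((biprod.fst : A ⊞ A' ⟶ A).hom z) +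
        (biprod.inr : A' ⟶ A ⊞ A').hom ((biprod.snd : A ⊞ A' ⟶ A').hom z) := by
    have := congrArg (fun f : A ⊞ A' ⟶ A ⊞ A' ↦ f.hom z) (biprod.total (X := A) (Y := A'))
    exact this.symm
  have : Mono θ := by
    refine (Rep.mono_iff_injective θ).mpr ((injective_iff_map_eq_zero θ.hom).mpr fun z hz ↦ ?_)
    rw [htotal z, hθ] at hz
    have h0 := (injective_iff_map_eq_zero _).mp hbij.1 _ hz
    rw [Prod.mk_eq_zero] at h0
    rw [htotal z, h0.1, h0.2, map_zero, map_zero, add_zero]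
  have : Epi θ := by
    refine (Rep.epi_iff_surjective θ).mpr fun y ↦ ?_
    obtain ⟨⟨x, x'⟩, rfl⟩ := hbij.2 y
    exact ⟨_, hθ x x'⟩
  have : IsIso θ := isIso_of_mono_of_epi θ
  exact ⟨(asIso θ).symm⟩

section Tensor

open TensorProduct

variable {A B : Rep k (Multiplicative (ZMod p))} {x : B.V}

theorem generatorSubOne_tmul (a : A.V) (b : B.V) :
    generatorSubOne (A ⊗ B) (a ⊗ₜ[k] b) =
      generatorSubOne A a ⊗ₜ[k] b + (a + generatorSubOne A a) ⊗ₜ[k] generatorSubOne B b := by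
  have h : (A ⊗ B).ρ (Multiplicative.ofAdd 1) (a ⊗ₜ[k] b) =
      A.ρ (Multiplicative.ofAdd 1) a ⊗ₜ[k] B.ρ (Multiplicative.ofAdd 1) b := rfl
  have h' := rho_ofAdd_one_apply (A ⊗ B) (a ⊗ₜ[k] b)
  rw [h, rho_ofAdd_one_apply, rho_ofAdd_one_apply] at h'
  rw [eq_comm, ← add_right_inj (a ⊗ₜ[k] b), ← h', tmul_add, add_tmul a (generatorSubOne A a) b,
    add_assoc]

theorem generatorSubOne_pow_tmul_of_apply_eq_zero {y : B.V} (hy : generatorSubOne B y = 0)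
    (a : A.V) (j : ℕ) :
    (generatorSubOne (A ⊗ B) ^ j) (a ⊗ₜ[k] y) = (generatorSubOne A ^ j) a ⊗ₜ[k] y := by
  induction j with
  | zero => rfl
  | succ j ih =>
    rw [pow_succ', End.mul_apply, ih, generatorSubOne_tmul, hy, tmul_zero, add_zero, pow_succ',
      End.mul_apply]

theorem generatorSubOne_pow_succ_tmul
    (hx : generatorSubOne B (generatorSubOne B x) = 0) (a : A.V) (j : ℕ) :
    (generatorSubOne (A ⊗ B) ^ (j + 1)) (a ⊗ₜ[k] x) =
      (generatorSubOne A ^ (j + 1)) a ⊗ₜ[k] x + ((j + 1 : ℕ) : k) •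
        (((generatorSubOne A ^ j) a + (generatorSubOne A ^ (j + 1)) a) ⊗ₜ[k]
          generatorSubOne B x) := by
  induction j with
  | zero =>
    rw [zero_add, pow_one, pow_one, pow_zero, Nat.cast_one, one_smul, generatorSubOne_tmul]
    rfl
  | succ j ih =>
    rw [pow_succ', End.mul_apply, ih, map_add, map_smul, generatorSubOne_tmul,
      generatorSubOne_tmul, hx, tmul_zero, add_zero, map_add, ← End.mul_apply, ← End.mul_apply,
      ← pow_succ', ← pow_succ', add_assoc]
    congr 1
    push_cast
    module

theorem exists_generatorSubOne_pow_tmul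
    (hx : generatorSubOne B (generatorSubOne B x) = 0) (a : A.V) (j : ℕ) :
    ∃ s : A.V, (generatorSubOne (A ⊗ B) ^ j) (a ⊗ₜ[k] x) =
      (generatorSubOne A ^ j) a ⊗ₜ[k] x + s ⊗ₜ[k] generatorSubOne B x := by
  cases j with
  | zero => exact ⟨0, by simp⟩
  | succ j => exact ⟨_, by rw [generatorSubOne_pow_succ_tmul hx, smul_tmul']⟩

theorem IsJordanGenerator.coeff_eq_zero_of_tmul {V W : Type*} [AddCommGroup V] [Module k V]
    [AddCommGroup W] [Module k W] {N : End k W} {x : W} (h : IsJordanGenerator N 1 x) {a s : V}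
    (ha : a ≠ 0) {α β : k}
    (hsum : α • (a ⊗ₜ[k] N x) + β • (a ⊗ₜ[k] x + s ⊗ₜ[k] N x) = 0) : α = 0 ∧ β = 0 := by
  let c (i : Fin 2) : V ⊗[k] W →ₗ[k] V :=
    (TensorProduct.rid k V).toLinearMap ∘ₗ LinearMap.lTensor V (h.basis.coord i)
  have hx : h.basis.repr x = Finsupp.single 0 1 := by
    simpa using h.basis.repr_self 0
  have hy : h.basis.repr (N x) = Finsupp.single 1 1 := by
    simpa using h.basis.repr_self 1
  have hβ : β = 0 := by simpa [c, hx, hy, ha] using congrArg (c 0) hsum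
  subst hβ
  exact ⟨by simpa [c, hx, hy, ha] using congrArg (c 1) hsum, rfl⟩

end Tensor

end CyclicGroupRepresentations

/-- **Proposition.** For `G = ℤ/pℤ` (`p` an odd prime) over a field of characteristic `p`,
with `V_i` the indecomposable representation of dimension `i + 1`:
`V_0 ⊗ V_1 ≅ V_1`; `V_d ⊗ V_1 ≅ V_{d+1} ⊕ V_{d-1}` for `0 < d < p − 1`; and
`V_{p-1} ⊗ V_1 ≅ V_{p-1} ⊕ V_{p-1}`. -/
theorem tensor_with_two_dimensional {k : Type} [Field k]
    (p : ℕ) [Fact p.Prime] (hodd : Odd p) [CharP k p]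
    (Vr : ℕ → Rep k (Multiplicative (ZMod p)))
    (hind : ∀ i ≤ p - 1, RepIndecomposable (Vr i))
    (hdim : ∀ i ≤ p - 1, Module.finrank k (Vr i).V = i + 1) :
    Nonempty ((Vr 0 ⊗ Vr 1 : Rep k (Multiplicative (ZMod p))) ≅ Vr 1) ∧
      (∀ d : ℕ, 0 < d → d < p - 1 →
        Nonempty ((Vr d ⊗ Vr 1 : Rep k (Multiplicative (ZMod p))) ≅
          Vr (d + 1) ⊞ Vr (d - 1))) ∧
      Nonempty ((Vr (p - 1) ⊗ Vr 1 : Rep k (Multiplicative (ZMod p))) ≅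
        Vr (p - 1) ⊞ Vr (p - 1)) := by
  obtain ⟨q, rfl⟩ : ∃ q, p = q + 1 :=
    Nat.exists_eq_succ_of_ne_zero (Fact.out : p.Prime).ne_zero
  have hq : 1 ≤ q := Nat.le_of_succ_le_succ (Fact.out : (q + 1).Prime).two_le
  simp only [Nat.add_sub_cancel] at *
  have hgen (i : ℕ) (hi : i ≤ q) := (hind i hi).exists_isJordanGenerator (hdim i hi)
  obtain ⟨x, hx⟩ := hgen 1 hq
  have hx2 : generatorSubOne (Vr 1) (generatorSubOne (Vr 1) x) = 0 := by
    simpa [pow_succ'] using hx.pow_succ_eq_zero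
  have hrank (i : ℕ) (hi : i ≤ q) : Module.finrank k (Vr i ⊗ Vr 1).V = (i + 1) * 2 :=
    (Module.finrank_tensorProduct (R := k) ..).trans (by rw [hdim i hi, hdim 1 hq])
  refine ⟨?_, fun d hd hdq ↦ ?_, ?_⟩
  · obtain ⟨v, hv⟩ := hgen 0 (Nat.zero_le q)
    have hv0 : generatorSubOne (Vr 0) v = 0 := by simpa using hv.pow_succ_eq_zero
    refine nonempty_iso_of_isJordanGenerator hx (u := TensorProduct.tmul k v x) ?_ ?_
      (hrank 0 (Nat.zero_le q))
    · rw [generatorSubOne_pow_succ_tmul hx2]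
      simp [pow_succ, hv0]
    · intro h
      rw [pow_one, generatorSubOne_tmul, hv0, TensorProduct.zero_tmul, zero_add, add_zero] at h
      exact one_ne_zero (hx.coeff_eq_zero_of_tmul (a := v) (s := 0) (α := (1 : k)) (β := 0)
        (by simpa using hv.pow_ne_zero) (by simpa using h)).1
  · obtain ⟨e, rfl⟩ := Nat.exists_eq_succ_of_ne_zero hd.ne'
    simp only [Nat.succ_eq_add_one, Nat.add_sub_cancel] at *
    obtain ⟨v, hv⟩ := hgen (e + 1) hdq.le
    obtain ⟨w, hw⟩ := hgen (e + 1 + 1) hdq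
    obtain ⟨w', hw'⟩ := hgen e (by omega)
    have hcast : ((e + 1 + 1 : ℕ) : k) ≠ 0 := by
      rw [Ne, CharP.cast_eq_zero_iff k (q + 1)]
      exact Nat.not_dvd_of_pos_of_lt (by omega) (by omega)
    refine nonempty_iso_biprod_of_isJordanGenerator hw hw' (u := TensorProduct.tmul k v x)
      (u' := TensorProduct.tmul k (generatorSubOne (Vr (e + 1)) v) x -
        ((e + 1 : ℕ) : k) • TensorProduct.tmul k v (generatorSubOne (Vr 1) x)) ?_ ?_ ?_ ?_
    · rw [generatorSubOne_pow_succ_tmul hx2, hv.pow_succ_eq_zero,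
        Module.End.pow_apply_eq_zero_of_le hv.pow_succ_eq_zero (Nat.le_succ _)]
      simp
    · rw [map_sub, map_smul, generatorSubOne_pow_succ_tmul hx2,
        generatorSubOne_pow_tmul_of_apply_eq_zero hx2, ← Module.End.mul_apply,
        ← Module.End.mul_apply, ← pow_succ, ← pow_succ, hv.pow_succ_eq_zero,
        TensorProduct.zero_tmul, zero_add, add_zero, sub_self]
    · intro a b hab
      obtain ⟨s, hs⟩ := exists_generatorSubOne_pow_tmul (A := Vr (e + 1)) hx2
        (generatorSubOne (Vr (e + 1)) v) e
      rw [map_sub, map_smul, hs, generatorSubOne_pow_succ_tmul hx2,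
        generatorSubOne_pow_tmul_of_apply_eq_zero hx2, ← Module.End.mul_apply, ← pow_succ,
        hv.pow_succ_eq_zero, TensorProduct.zero_tmul, zero_add, add_zero, smul_smul, add_sub_assoc,
        TensorProduct.smul_tmul', TensorProduct.smul_tmul', ← TensorProduct.sub_tmul] at hab
      obtain ⟨ha, hb⟩ := hx.coeff_eq_zero_of_tmul hv.pow_ne_zero hab
      exact ⟨(mul_eq_zero.mp ha).resolve_right hcast, hb⟩
    · rw [hrank _ hdq.le]
      ring
  · obtain ⟨v, hv⟩ := hgen q le_rfl
    refine nonempty_iso_biprod_of_isJordanGenerator hv hv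
      (u := TensorProduct.tmul k v (generatorSubOne (Vr 1) x))
      (u' := TensorProduct.tmul k v x) ?_ ?_ ?_ ?_
    · rw [generatorSubOne_pow_tmul_of_apply_eq_zero hx2, hv.pow_succ_eq_zero,
        TensorProduct.zero_tmul]
    · rw [generatorSubOne_pow_char, LinearMap.zero_apply]
    · intro a b hab
      obtain ⟨s, hs⟩ := exists_generatorSubOne_pow_tmul (A := Vr q) hx2 v q
      rw [hs, generatorSubOne_pow_tmul_of_apply_eq_zero hx2] at hab
      exact hx.coeff_eq_zero_of_tmul hv.pow_ne_zero hab
    · rw [hrank q le_rfl]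
      ring
end
end

section
/- Let p be an odd prime, K a field of characteristic p, and G = Z/pZ, with 0 ≤ m, n ≤ p−1. If m + n ≤ p−1, then V_m ⊗ V_n ≅ V_{|m−n|} ⊕ V_{|m−n|+2} ⊕ ⋯ ⊕ V_{m+n}. If m + n = p−2+d with d ≥ 1, then V_m ⊗ V_n ≅ (V_{p−1})^{⊕d} ⊕ (V_{m−d} ⊗ V_{n−d}). -/
open CategoryTheory MonoidalCategory Limits

noncomputable section

universe u

attribute [local instance] CategoryTheory.Abelian.hasFiniteBiproducts

open Module in
/-- The vectors `w i` generate Jordan chains of lengths `l i + 1` for `N` which together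
form a basis of the whole space. -/
structure IsJordanSystem {k W ι : Type*} [Field k] [AddCommGroup W] [Module k W]
    (N : Module.End k W) (l : ι → ℕ) (w : ι → W) : Prop where
  pow_succ_apply : ∀ i, (N ^ (l i + 1)) (w i) = 0
  linearIndependent_top : LinearIndependent k fun i => (N ^ l i) (w i)
  span_eq_top : ⊤ ≤ Submodule.span k
    (Set.range fun q : (Σ i, Fin (l i + 1)) => (N ^ (q.2 : ℕ)) (w q.1))

section JordanSystem

open Module

variable {k W W' ι : Type*} [Field k] [AddCommGroup W] [Module k W]
  [AddCommGroup W'] [Module k W'] [Fintype ι]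

lemma pow_apply_eq_zero_of_le {N : Module.End k W} {v : W} {a b : ℕ} (h : (N ^ a) v = 0)
    (hab : a ≤ b) : (N ^ b) v = 0 := by
  obtain ⟨c, rfl⟩ := Nat.exists_eq_add_of_le hab
  rw [add_comm, pow_add, Module.End.mul_apply, h, map_zero]

lemma linearIndependent_jordan_chains {N : Module.End k W} {l : ι → ℕ} {w : ι → W}
    (h0 : ∀ i, (N ^ (l i + 1)) (w i) = 0)
    (hli : LinearIndependent k fun i => (N ^ l i) (w i)) :
    LinearIndependent k
      fun q : (Σ i, Fin (l i + 1)) => (N ^ (q.2 : ℕ)) (w q.1) := by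
  classical
  rw [Fintype.linearIndependent_iff]
  intro g hg
  by_contra! hne
  obtain ⟨q₁, hq₁⟩ := hne
  obtain ⟨q₀, hq₀, hmax⟩ := Finset.exists_max_image
    (Finset.univ.filter fun q : (Σ i, Fin (l i + 1)) => g q ≠ 0)
    (fun q => l q.1 - (q.2 : ℕ)) ⟨q₁, by simpa using hq₁⟩
  simp only [Finset.mem_filter, Finset.mem_univ, true_and] at hq₀ hmax
  obtain ⟨r, hr⟩ : ∃ r, l q₀.1 - (q₀.2 : ℕ) = r := ⟨_, rfl⟩
  rw [hr] at hmax
  have hlt : ∀ q : (Σ i, Fin (l i + 1)), (q.2 : ℕ) ≤ l q.1 := fun q => by have := q.2.2; omega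
  have hterm : ∀ q : (Σ i, Fin (l i + 1)), (N ^ r) (g q • (N ^ (q.2 : ℕ)) (w q.1)) =
      (if r + (q.2 : ℕ) = l q.1 then g q else 0) • (N ^ l q.1) (w q.1) := by
    intro q
    rw [map_smul, ← Module.End.mul_apply, ← pow_add]
    split_ifs with h
    · rw [h]
    · by_cases hgq : g q = 0
      · simp [hgq]
      · have := hmax q hgq
        rw [pow_apply_eq_zero_of_le (h0 q.1) (by omega), smul_zero, zero_smul]
  have hsum := congrArg (N ^ r) hg
  rw [map_sum, map_zero, Finset.sum_congr rfl fun q _ => hterm q, Fintype.sum_sigma] at hsum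
  simp only [← Finset.sum_smul] at hsum
  have := Fintype.linearIndependent_iff.1 hli _ hsum q₀.1
  rw [Finset.sum_eq_single q₀.2] at this
  · have h2 := hlt q₀
    rw [if_pos (by omega)] at this
    exact hq₀ this
  · intro s _ hs
    rw [if_neg]
    intro h
    have h2 := hlt q₀
    exact hs (Fin.ext (by omega))
  · simp

lemma IsJordanSystem.of_finrank [FiniteDimensional k W] {N : Module.End k W} {l : ι → ℕ}
    {w : ι → W}
    (h0 : ∀ i, (N ^ (l i + 1)) (w i) = 0)
    (hli : LinearIndependent k fun i => (N ^ l i) (w i))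
    (hdim : ∑ i, (l i + 1) = finrank k W) : IsJordanSystem N l w where
  pow_succ_apply := h0
  linearIndependent_top := hli
  span_eq_top := by
    rw [(linearIndependent_jordan_chains h0 hli).span_eq_top_of_card_eq_finrank' (by simpa)]

lemma IsJordanSystem.exists_equiv {N : Module.End k W} {N' : Module.End k W'} {l : ι → ℕ}
    {w : ι → W} {w' : ι → W'} (h : IsJordanSystem N l w) (h' : IsJordanSystem N' l w') :
    ∃ e : W ≃ₗ[k] W', ∀ x, e (N x) = N' (e x) := by
  let B := Basis.mk (linearIndependent_jordan_chains h.1 h.2) h.3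
  let B' := Basis.mk (linearIndependent_jordan_chains h'.1 h'.2) h'.3
  let e := B.equiv B' (Equiv.refl _)
  have he : ∀ i s, s ≤ l i + 1 → e ((N ^ s) (w i)) = (N' ^ s) (w' i) := by
    intro i s hs
    rcases hs.eq_or_lt with rfl | hs
    · rw [h.1, h'.1, map_zero]
    · have := B.equiv_apply ⟨i, ⟨s, hs⟩⟩ B' (Equiv.refl _)
      simpa [B, B', Basis.mk_apply] using this
  refine ⟨e, fun x => ?_⟩
  have : e.toLinearMap ∘ₗ N = N' ∘ₗ e.toLinearMap := by
    refine B.ext fun q => ?_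
    have h1 := q.2.2
    have h2 := he q.1 q.2 (by omega)
    have h3 := he q.1 (q.2 + 1) (by omega)
    simp only [pow_succ', Module.End.mul_apply] at h3
    simp only [B, Basis.mk_apply, LinearMap.comp_apply, LinearEquiv.coe_coe, h2, h3]
  exact LinearMap.congr_fun this x

end JordanSystem

open Module in
/-- Commuting operators `X`, `Y` and a vector `u` exhibiting `W` as the cyclic module
`k[X, Y] / (X ^ (m + 1), Y ^ (n + 1))` generated by `u`. -/
structure IsBoxSystem {k W : Type*} [Field k] [AddCommGroup W] [Module k W]
    (X Y : Module.End k W) (u : W) (m n : ℕ) : Prop where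
  comm : Commute X Y
  pow_left : X ^ (m + 1) = 0
  pow_right : Y ^ (n + 1) = 0
  top_ne_zero : (X ^ m) ((Y ^ n) u) ≠ 0
  finrank_eq : finrank k W = (m + 1) * (n + 1)

lemma cast_choose_ne_zero {k : Type*} [Field k] {p : ℕ} [hp : Fact p.Prime] [CharP k p]
    {a b : ℕ} (ha : a < p) (hb : b ≤ a) : ((a.choose b : ℕ) : k) ≠ 0 := by
  rw [Ne, CharP.cast_eq_zero_iff k p]
  intro hdvd
  have := (hdvd.mul_right (b.factorial)).mul_right ((a - b).factorial)
  rw [Nat.choose_mul_factorial_mul_factorial hb, hp.out.dvd_factorial] at this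
  omega

lemma sum_jordan_lengths (m n : ℕ) :
    ∑ j : Fin (min m n + 1), (max m n - min m n + 2 * (j : ℕ) + 1) = (m + 1) * (n + 1) := by
  have key : ∀ a b : ℕ, ∑ j ∈ Finset.range (a + 1), (b + 2 * j + 1) = (a + 1) * (a + b + 1) := by
    intro a b
    induction a with
    | zero => simp
    | succ a ih => rw [Finset.sum_range_succ, ih]; ring
  rw [Fin.sum_univ_eq_sum_range (fun j => max m n - min m n + 2 * j + 1), key]
  rcases le_total m n with hmn | hmn
  · rw [max_eq_right hmn, min_eq_left hmn, Nat.add_sub_cancel' hmn]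
  · rw [max_eq_left hmn, min_eq_right hmn, Nat.add_sub_cancel' hmn, mul_comm]

namespace IsBoxSystem

open Module

variable {k W : Type*} [Field k] [AddCommGroup W] [Module k W]
  {X Y : Module.End k W} {u : W} {m n : ℕ}

lemma pow_apply_comm (h : IsBoxSystem X Y u m n) (s t : ℕ) (v : W) :
    (Y ^ t) ((X ^ s) v) = (X ^ s) ((Y ^ t) v) := by
  rw [← Module.End.mul_apply, ← Module.End.mul_apply, (h.comm.pow_pow s t).eq]

lemma left_apply (s t : ℕ) : X ((X ^ s) ((Y ^ t) u)) = (X ^ (s + 1)) ((Y ^ t) u) := by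
  rw [pow_succ', Module.End.mul_apply]

lemma right_apply (h : IsBoxSystem X Y u m n) (s t : ℕ) :
    Y ((X ^ s) ((Y ^ t) u)) = (X ^ s) ((Y ^ (t + 1)) u) := by
  have := h.pow_apply_comm s 1 ((Y ^ t) u)
  rw [pow_one] at this
  rw [this, pow_succ', Module.End.mul_apply]

lemma eq_zero_of_lt (h : IsBoxSystem X Y u m n) {s t : ℕ} (hst : m < s ∨ n < t) :
    (X ^ s) ((Y ^ t) u) = 0 := by
  rcases hst with hst | hst
  · exact pow_apply_eq_zero_of_le (by rw [h.pow_left]; rfl) hst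
  · rw [pow_apply_eq_zero_of_le (a := n + 1) (by rw [h.pow_right]; rfl) hst, map_zero]

lemma linearIndependent (h : IsBoxSystem X Y u m n) :
    LinearIndependent k
      fun q : Fin (m + 1) × Fin (n + 1) => (X ^ (q.1 : ℕ)) ((Y ^ (q.2 : ℕ)) u) := by
  classical
  rw [Fintype.linearIndependent_iff]
  intro g hg
  by_contra! hne
  obtain ⟨q₁, hq₁⟩ := hne
  obtain ⟨q₀, hq₀, hmin⟩ := Finset.exists_min_image
    (Finset.univ.filter fun q : Fin (m + 1) × Fin (n + 1) => g q ≠ 0)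
    (fun q => (q.1 : ℕ) + q.2) ⟨q₁, by simpa using hq₁⟩
  simp only [Finset.mem_filter, Finset.mem_univ, true_and] at hq₀ hmin
  have hsum := congrArg (fun v => (X ^ (m - q₀.1)) ((Y ^ (n - q₀.2)) v)) hg
  simp only [map_sum, map_zero, map_smul, h.pow_apply_comm] at hsum
  simp only [← Module.End.mul_apply, ← mul_assoc, ← pow_add] at hsum
  simp only [Module.End.mul_apply] at hsum
  have h1 := q₀.1.2
  have h2 := q₀.2.2
  rw [Finset.sum_eq_single q₀] at hsum
  · rw [Nat.sub_add_cancel (by omega), Nat.sub_add_cancel (by omega)] at hsum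
    exact (smul_ne_zero hq₀ h.top_ne_zero) hsum
  · intro q _ hq
    by_cases hgq : g q = 0
    · rw [hgq, zero_smul]
    · have h3 := hmin q hgq
      rw [h.eq_zero_of_lt, smul_zero]
      by_contra! hcon
      exact hq (Prod.ext (Fin.ext (by omega)) (Fin.ext (by omega)))
  · simp

lemma finiteDimensional (h : IsBoxSystem X Y u m n) : FiniteDimensional k W :=
  Module.finite_of_finrank_pos (by rw [h.finrank_eq]; positivity)

/-- The monomial basis of a box system. -/
noncomputable def basis (h : IsBoxSystem X Y u m n) : Basis (Fin (m + 1) × Fin (n + 1)) k W :=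
  have := h.finiteDimensional
  Basis.mk h.linearIndependent
    (by rw [h.linearIndependent.span_eq_top_of_card_eq_finrank' (by simp [h.finrank_eq])])

lemma basis_apply (h : IsBoxSystem X Y u m n) (q : Fin (m + 1) × Fin (n + 1)) :
    h.basis q = (X ^ (q.1 : ℕ)) ((Y ^ (q.2 : ℕ)) u) := by
  simp [basis]

lemma repr_monomial (h : IsBoxSystem X Y u m n) (s t : ℕ) (q : Fin (m + 1) × Fin (n + 1)) :
    h.basis.repr ((X ^ s) ((Y ^ t) u)) q = if (q.1 : ℕ) = s ∧ (q.2 : ℕ) = t then 1 else 0 := by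
  by_cases hst : s < m + 1 ∧ t < n + 1
  · have := h.basis.repr_self_apply (⟨s, hst.1⟩, ⟨t, hst.2⟩) q
    rw [basis_apply] at this
    simp only [this, Prod.ext_iff, Fin.ext_iff, eq_comm]
  · have h1 := q.1.2
    have h2 := q.2.2
    rw [h.eq_zero_of_lt (by omega), if_neg (by omega)]
    simp

/-- The span of the monomials of total degree `j`. -/
def homogeneous (X Y : Module.End k W) (u : W) (j : ℕ) : Submodule k W :=
  Submodule.span k {v | ∃ s t, s + t = j ∧ v = (X ^ s) ((Y ^ t) u)}

lemma monomial_mem (X Y : Module.End k W) (u : W) {s t j : ℕ} (hst : s + t = j) :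
    (X ^ s) ((Y ^ t) u) ∈ homogeneous X Y u j :=
  Submodule.subset_span ⟨s, t, hst, rfl⟩

lemma homogeneous_eq_bot (h : IsBoxSystem X Y u m n) {j : ℕ} (hj : m + n < j) :
    homogeneous X Y u j = ⊥ := by
  rw [homogeneous, Submodule.span_eq_bot]
  rintro _ ⟨s, t, hst, rfl⟩
  exact h.eq_zero_of_lt (by omega)

lemma add_apply_mem (h : IsBoxSystem X Y u m n) {j : ℕ} {v : W} (hv : v ∈ homogeneous X Y u j) :
    (X + Y) v ∈ homogeneous X Y u (j + 1) := by
  refine (Submodule.span_le (p := (homogeneous X Y u (j + 1)).comap (X + Y))).2 ?_ hv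
  rintro _ ⟨s, t, hst, rfl⟩
  simp only [SetLike.mem_coe, Submodule.mem_comap, LinearMap.add_apply, left_apply, h.right_apply]
  exact add_mem (monomial_mem X Y u (by omega)) (monomial_mem X Y u (by omega))

lemma add_pow_apply_mem (h : IsBoxSystem X Y u m n) {j : ℕ} {v : W}
    (hv : v ∈ homogeneous X Y u j) (r : ℕ) : ((X + Y) ^ r) v ∈ homogeneous X Y u (j + r) := by
  induction r with
  | zero => simpa using hv
  | succ r ih => rw [pow_succ', Module.End.mul_apply]; exact h.add_apply_mem ih

lemma repr_eq_zero (h : IsBoxSystem X Y u m n) {j : ℕ} {v : W} (hv : v ∈ homogeneous X Y u j)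
    {q : Fin (m + 1) × Fin (n + 1)} (hq : (q.1 : ℕ) + q.2 ≠ j) : h.basis.repr v q = 0 := by
  refine (Submodule.span_le (p := LinearMap.ker (h.basis.coord q))).2 ?_ hv
  rintro _ ⟨s, t, hst, rfl⟩
  simp only [SetLike.mem_coe, LinearMap.mem_ker, Basis.coord_apply, repr_monomial]
  exact if_neg (by omega)

lemma linearIndependent_of_homogeneous (h : IsBoxSystem X Y u m n) {ι : Type*} {x : ι → W}
    {δ : ι → ℕ} (hδ : Function.Injective δ) (hx : ∀ i, x i ∈ homogeneous X Y u (δ i))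
    (hx0 : ∀ i, x i ≠ 0) : LinearIndependent k x := by
  rw [linearIndependent_iff']
  intro s c hc i hi
  have hne : h.basis.repr (x i) ≠ 0 := by simpa using hx0 i
  obtain ⟨q, hq⟩ := Finsupp.ne_iff.1 hne
  have hdeg : (q.1 : ℕ) + q.2 = δ i := by
    by_contra hcon
    exact hq (h.repr_eq_zero (hx i) hcon)
  have hsum := congrArg (fun v => h.basis.repr v q) hc
  simp only [map_sum, map_smul, map_zero, Finsupp.coe_finsetSum, Finset.sum_apply,
    Finsupp.smul_apply, Finsupp.coe_zero, Pi.zero_apply, smul_eq_mul] at hsum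
  rw [Finset.sum_eq_single i] at hsum
  · exact (mul_eq_zero.1 hsum).resolve_right hq
  · intro j _ hj
    rw [h.repr_eq_zero (hx j) (fun h' => hj (hδ (h'.symm.trans hdeg))), mul_zero]
  · exact fun h' => (h' hi).elim

/-- The lowering operator of the `sl₂`-action whose raising operator is `X + Y`. -/
lemma exists_lowering (h : IsBoxSystem X Y u m n) : ∃ f : Module.End k W, ∀ s t : ℕ,
    f ((X ^ s) ((Y ^ t) u)) = ((s : k) * (m + 1 - s)) • (X ^ (s - 1)) ((Y ^ t) u) +
      ((t : k) * (n + 1 - t)) • (X ^ s) ((Y ^ (t - 1)) u) := by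
  refine ⟨h.basis.constr k fun q =>
    (((q.1 : ℕ) : k) * (m + 1 - (q.1 : ℕ))) • (X ^ ((q.1 : ℕ) - 1)) ((Y ^ (q.2 : ℕ)) u) +
    (((q.2 : ℕ) : k) * (n + 1 - (q.2 : ℕ))) • (X ^ (q.1 : ℕ)) ((Y ^ ((q.2 : ℕ) - 1)) u),
    fun s t => ?_⟩
  by_cases hst : s < m + 1 ∧ t < n + 1
  · have := h.basis.constr_basis k (fun q =>
      (((q.1 : ℕ) : k) * (m + 1 - (q.1 : ℕ))) • (X ^ ((q.1 : ℕ) - 1)) ((Y ^ (q.2 : ℕ)) u) +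
      (((q.2 : ℕ) : k) * (n + 1 - (q.2 : ℕ))) • (X ^ (q.1 : ℕ)) ((Y ^ ((q.2 : ℕ) - 1)) u))
      (⟨s, hst.1⟩, ⟨t, hst.2⟩)
    rwa [basis_apply] at this
  · rw [h.eq_zero_of_lt (by omega), map_zero, eq_comm]
    have h1 : ((s : k) * (m + 1 - s)) • (X ^ (s - 1)) ((Y ^ t) u) = 0 := by
      by_cases hs : s = m + 1
      · simp [hs]
      · rw [h.eq_zero_of_lt (by omega), smul_zero]
    have h2 : ((t : k) * (n + 1 - t)) • (X ^ s) ((Y ^ (t - 1)) u) = 0 := by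
      by_cases ht : t = n + 1
      · simp [ht]
      · rw [h.eq_zero_of_lt (by omega), smul_zero]
    rw [h1, h2, add_zero]

lemma lowering_add_apply (h : IsBoxSystem X Y u m n) {f : Module.End k W}
    (hf : ∀ s t : ℕ, f ((X ^ s) ((Y ^ t) u)) =
      ((s : k) * (m + 1 - s)) • (X ^ (s - 1)) ((Y ^ t) u) +
      ((t : k) * (n + 1 - t)) • (X ^ s) ((Y ^ (t - 1)) u))
    {j : ℕ} {v : W} (hv : v ∈ homogeneous X Y u j) :
    f ((X + Y) v) = (X + Y) (f v) + ((m : k) + n - 2 * j) • v := by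
  refine (Submodule.span_le (p := LinearMap.eqLocus (f * (X + Y))
    ((X + Y) * f + ((m : k) + n - 2 * j) • (1 : Module.End k W)))).2 ?_ hv
  rintro _ ⟨s, t, rfl, rfl⟩
  simp only [SetLike.mem_coe, LinearMap.mem_eqLocus, Module.End.mul_apply, LinearMap.add_apply,
    LinearMap.smul_apply, Module.End.one_apply, left_apply, h.right_apply, map_add, hf, map_smul]
  rcases s with _ | s <;> rcases t with _ | t <;>
  simp only [Nat.add_sub_cancel, Nat.cast_add, Nat.cast_one, Nat.cast_zero, zero_mul, zero_smul,
    zero_add, add_zero, Nat.sub_self] <;> module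

lemma lowering_add_pow_apply (h : IsBoxSystem X Y u m n) {f : Module.End k W}
    (hf : ∀ s t : ℕ, f ((X ^ s) ((Y ^ t) u)) =
      ((s : k) * (m + 1 - s)) • (X ^ (s - 1)) ((Y ^ t) u) +
      ((t : k) * (n + 1 - t)) • (X ^ s) ((Y ^ (t - 1)) u))
    {i : ℕ} {w : W} (hw : w ∈ homogeneous X Y u i) (hfw : f w = 0) (r : ℕ) :
    f (((X + Y) ^ (r + 1)) w) =
      (((r : k) + 1) * (m + n - 2 * i - r)) • ((X + Y) ^ r) w := by
  induction r with
  | zero => simpa [hfw] using h.lowering_add_apply hf hw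
  | succ r ih =>
    have := h.lowering_add_apply hf (h.add_pow_apply_mem hw (r + 1))
    rw [ih, map_smul, ← Module.End.mul_apply (X + Y), ← pow_succ', ← Module.End.mul_apply (X + Y),
      ← pow_succ', ← add_smul] at this
    rw [this]
    push_cast
    congr 1
    ring

/-- A primitive vector of degree `i` for the lowering operator. -/
lemma exists_primitive (h : IsBoxSystem X Y u m n) {f : Module.End k W}
    (hf : ∀ s t : ℕ, f ((X ^ s) ((Y ^ t) u)) =
      ((s : k) * (m + 1 - s)) • (X ^ (s - 1)) ((Y ^ t) u) +
      ((t : k) * (n + 1 - t)) • (X ^ s) ((Y ^ (t - 1)) u))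
    {p : ℕ} [Fact p.Prime] [CharP k p] (hmp : m < p)
    {i : ℕ} (him : i ≤ m) (hin : i ≤ n) :
    ∃ w ∈ homogeneous X Y u i, f w = 0 ∧ w ≠ 0 := by
  let c : ℕ → k := fun j => (-1) ^ j * ((m - j).choose (i - j) * (n - i + j).choose j : ℕ)
  refine ⟨∑ j ∈ Finset.range (i + 1), c j • (X ^ j) ((Y ^ (i - j)) u), ?_, ?_, ?_⟩
  · exact sum_mem fun j hj => Submodule.smul_mem _ _
      (monomial_mem X Y u (by have := Finset.mem_range.1 hj; omega))
  · simp only [map_sum, map_smul, hf, smul_add, Finset.sum_add_distrib]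
    rw [Finset.sum_range_succ', Finset.sum_range_succ (fun j => c j • _ • _)]
    simp only [Nat.cast_zero, zero_mul, zero_smul, smul_zero, add_zero, Nat.sub_self,
      ← Finset.sum_add_distrib]
    refine Finset.sum_eq_zero fun j hj => ?_
    have hj' := Finset.mem_range.1 hj
    have e1 : i - (j + 1) = i - j - 1 := by omega
    rw [Nat.add_sub_cancel, e1, smul_smul, smul_smul, ← add_smul]
    convert zero_smul k _
    have hc1 := Nat.add_one_mul_choose_eq (m - j - 1) (i - j - 1)
    have hc2 := Nat.add_one_mul_choose_eq (n - i + j) j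
    rw [show m - j - 1 + 1 = m - j by omega, show i - j - 1 + 1 = i - j by omega] at hc1
    have hc1' := congrArg (Nat.cast (R := k)) hc1
    have hc2' := congrArg (Nat.cast (R := k)) hc2
    have em : ((m - j : ℕ) : k) = m - j := by rw [Nat.cast_sub (by omega)]
    have ei : ((i - j : ℕ) : k) = i - j := by rw [Nat.cast_sub (by omega)]
    have en : ((n - i : ℕ) : k) = n - i := by rw [Nat.cast_sub (by omega)]
    simp only [Nat.cast_mul, Nat.cast_add, Nat.cast_one, em, ei, en] at hc1' hc2'
    simp only [c, Nat.cast_mul, Nat.cast_add, Nat.cast_one, ei, pow_succ,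
      show m - (j + 1) = m - j - 1 by omega, ← add_assoc]
    rw [← e1] at hc1'
    linear_combination (-1) ^ (j + 1) * ((n - i + j + 1).choose (j + 1) : k) * (j + 1) * hc1' -
      (-1) ^ (j + 1) * ((m - j).choose (i - j) : k) * ((i : k) - j) * hc2'
  · intro h0
    have hr := congrArg (fun v => h.basis.repr v (0, ⟨i, by omega⟩)) h0
    simp only [map_sum, map_smul, map_zero, Finsupp.coe_finsetSum, Finset.sum_apply,
      Finsupp.smul_apply, Finsupp.coe_zero, Pi.zero_apply, smul_eq_mul, repr_monomial] at hr
    rw [Finset.sum_eq_single 0 _ (by simp)] at hr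
    · simp only [c, Fin.val_zero, Nat.sub_zero, true_and, if_true, pow_zero, one_mul, mul_one,
        Nat.choose_zero_right] at hr
      exact cast_choose_ne_zero hmp him hr
    · intro j _ hj
      rw [if_neg (by simp; omega), mul_zero]

lemma add_pow_ne_zero_of_primitive (h : IsBoxSystem X Y u m n) {f : Module.End k W}
    (hf : ∀ s t : ℕ, f ((X ^ s) ((Y ^ t) u)) =
      ((s : k) * (m + 1 - s)) • (X ^ (s - 1)) ((Y ^ t) u) +
      ((t : k) * (n + 1 - t)) • (X ^ s) ((Y ^ (t - 1)) u))
    {p : ℕ} [CharP k p] {i l : ℕ} (hl : m + n = 2 * i + l) (hlp : l < p) {w : W}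
    (hw : w ∈ homogeneous X Y u i) (hfw : f w = 0) (hw0 : w ≠ 0) :
    ((X + Y) ^ l) w ≠ 0 := by
  have key : ∀ r ≤ l, ((X + Y) ^ r) w ≠ 0 := by
    intro r
    induction r with
    | zero => simpa using hw0
    | succ r ih =>
      intro hr h0
      have h1 := h.lowering_add_pow_apply hf hw hfw r
      have hc : ((r : k) + 1) * (m + n - 2 * i - r) = ((r + 1 : ℕ) : k) * ((l - r : ℕ) : k) := by
        have := congrArg (Nat.cast (R := k)) hl
        push_cast [Nat.cast_sub (show r ≤ l by omega)] at this ⊢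
        linear_combination ((r : k) + 1) * this
      rw [h0, map_zero, hc, eq_comm, smul_eq_zero, mul_eq_zero, CharP.cast_eq_zero_iff k p,
        CharP.cast_eq_zero_iff k p] at h1
      rcases h1 with (h1 | h1) | h1
      · exact absurd (Nat.le_of_dvd (by omega) h1) (by omega)
      · exact absurd (Nat.le_of_dvd (by omega) h1) (by omega)
      · exact ih (by omega) h1
  exact key l le_rfl

lemma add_pow_succ_eq_zero_of_primitive (h : IsBoxSystem X Y u m n) {f : Module.End k W}
    (hf : ∀ s t : ℕ, f ((X ^ s) ((Y ^ t) u)) =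
      ((s : k) * (m + 1 - s)) • (X ^ (s - 1)) ((Y ^ t) u) +
      ((t : k) * (n + 1 - t)) • (X ^ s) ((Y ^ (t - 1)) u))
    {p : ℕ} [CharP k p] {i l : ℕ} (hl : m + n = 2 * i + l) (hlp : i = 0 ∨ l + i + 1 < p) {w : W}
    (hw : w ∈ homogeneous X Y u i) (hfw : f w = 0) :
    ((X + Y) ^ (l + 1)) w = 0 := by
  have key : ∀ c ≤ i, ((X + Y) ^ (l + 1 + c)) w = 0 → ((X + Y) ^ (l + 1)) w = 0 := by
    intro c
    induction c with
    | zero => exact fun _ h' => h'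
    | succ c ih =>
      intro hc h0
      refine ih (by omega) ?_
      have h1 := h.lowering_add_pow_apply hf hw hfw (l + 1 + c)
      have hco : (((l + 1 + c : ℕ) : k) + 1) * (m + n - 2 * i - (l + 1 + c : ℕ)) =
          -(((l + c + 2 : ℕ) : k) * ((c + 1 : ℕ) : k)) := by
        have := congrArg (Nat.cast (R := k)) hl
        push_cast at this ⊢
        linear_combination ((l : k) + 1 + c + 1) * this
      rw [add_assoc (l + 1), h0, map_zero, hco, eq_comm, smul_eq_zero, neg_eq_zero, mul_eq_zero,
        CharP.cast_eq_zero_iff k p, CharP.cast_eq_zero_iff k p] at h1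
      rcases h1 with (h1 | h1) | h1
      · exact absurd (Nat.le_of_dvd (by omega) h1) (by omega)
      · exact absurd (Nat.le_of_dvd (by omega) h1) (by omega)
      · exact h1
  refine key i le_rfl ?_
  have := h.add_pow_apply_mem hw (l + 1 + i)
  rwa [h.homogeneous_eq_bot (by omega), Submodule.mem_bot] at this

lemma exists_jordan_vector (h : IsBoxSystem X Y u m n) {p : ℕ} [Fact p.Prime] [CharP k p]
    (hmp : m < p) {i l : ℕ} (him : i ≤ m) (hin : i ≤ n) (hl : m + n = 2 * i + l) (hlp : l < p)
    (hip : i = 0 ∨ l + i + 1 < p) :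
    ∃ w ∈ homogeneous X Y u i, ((X + Y) ^ (l + 1)) w = 0 ∧ ((X + Y) ^ l) w ≠ 0 := by
  obtain ⟨f, hf⟩ := h.exists_lowering
  obtain ⟨w, hw, hfw, hw0⟩ := h.exists_primitive hf (p := p) hmp him hin
  exact ⟨w, hw, h.add_pow_succ_eq_zero_of_primitive hf (p := p) hl hip hw hfw,
    h.add_pow_ne_zero_of_primitive hf hl hlp hw hfw hw0⟩

lemma add_pow_apply_monomial_ne_zero (h : IsBoxSystem X Y u m n) {p : ℕ} [Fact p.Prime]
    [CharP k p] (hmp : m < p) {i : ℕ} (him : i ≤ m) (hin : p - 1 + i ≤ m + n) :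
    ((X + Y) ^ (p - 1)) ((X ^ i) u) ≠ 0 := by
  intro h0
  have hr := congrArg (fun v => h.basis.repr v (⟨m, by omega⟩, ⟨p - 1 + i - m, by omega⟩)) h0
  simp only [h.comm.add_pow, LinearMap.sum_apply] at hr
  have hterm : ∀ j ∈ Finset.range (p - 1 + 1),
      (X ^ j * Y ^ (p - 1 - j) * ((p - 1).choose j : Module.End k W)) ((X ^ i) u) =
        ((p - 1).choose j : k) • (X ^ (j + i)) ((Y ^ (p - 1 - j)) u) := by
    intro j _
    rw [Module.End.mul_apply, Module.End.natCast_apply, map_nsmul, ← Nat.cast_smul_eq_nsmul k,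
      Module.End.mul_apply, h.pow_apply_comm, ← Module.End.mul_apply, ← pow_add]
  rw [Finset.sum_congr rfl hterm] at hr
  simp only [map_sum, map_smul, map_zero, Finsupp.coe_finsetSum, Finset.sum_apply,
    Finsupp.smul_apply, Finsupp.coe_zero, Pi.zero_apply, smul_eq_mul, repr_monomial] at hr
  rw [Finset.sum_eq_single (m - i)] at hr
  · rw [if_pos (by omega), mul_one] at hr
    exact cast_choose_ne_zero (k := k) (p := p) (by omega) (by omega) hr
  · intro j _ hj
    rw [if_neg (by omega), mul_zero]
  · intro hmem
    simp only [Finset.mem_range, not_lt] at hmem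
    omega

lemma exists_isJordanSystem_of_add_lt (h : IsBoxSystem X Y u m n) {p : ℕ} [Fact p.Prime]
    [CharP k p] (hmn : m + n < p) :
    ∃ w : Fin (min m n + 1) → W,
      IsJordanSystem (X + Y) (fun j : Fin (min m n + 1) => max m n - min m n + 2 * (j : ℕ)) w := by
  have := h.finiteDimensional
  have hex : ∀ j : Fin (min m n + 1), ∃ w ∈ homogeneous X Y u (min m n - j),
      ((X + Y) ^ (max m n - min m n + 2 * (j : ℕ) + 1)) w = 0 ∧
      ((X + Y) ^ (max m n - min m n + 2 * (j : ℕ))) w ≠ 0 := by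
    intro j
    have hj := j.2
    exact h.exists_jordan_vector (p := p) (by omega) (by omega) (by omega) (by omega) (by omega)
      (by omega)
  choose w hw hw0 hw1 using hex
  refine ⟨w, .of_finrank hw0 (h.linearIndependent_of_homogeneous
    (δ := fun j : Fin (min m n + 1) => min m n - j + (max m n - min m n + 2 * (j : ℕ))) ?_
    (fun j => h.add_pow_apply_mem (hw j) _) hw1) ?_⟩
  · intro a b hab
    have ha := a.2
    have hb := b.2
    simp only at hab
    exact Fin.ext (by omega)
  · rw [h.finrank_eq]
    exact sum_jordan_lengths m n

lemma exists_isJordanSystem_of_le_add (h : IsBoxSystem X Y u m n) {p : ℕ} [Fact p.Prime]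
    [CharP k p] {d : ℕ} (hdm : d ≤ m) (hdn : d ≤ n) (hd : 1 ≤ d) (hmn : m + n + 2 = p + d)
    (hp : (X + Y) ^ p = 0) :
    ∃ w : Fin d ⊕ Fin (min (m - d) (n - d) + 1) → W,
      IsJordanSystem (X + Y) (Sum.elim (fun _ => p - 1)
        (fun j : Fin (min (m - d) (n - d) + 1) =>
          max (m - d) (n - d) - min (m - d) (n - d) + 2 * (j : ℕ))) w := by
  have := h.finiteDimensional
  have hp2 := (Fact.out : p.Prime).two_le
  set l : Fin d ⊕ Fin (min (m - d) (n - d) + 1) → ℕ := Sum.elim (fun _ => p - 1)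
        (fun j : Fin (min (m - d) (n - d) + 1) => max (m - d) (n - d) - min (m - d) (n - d) + 2 * (j : ℕ)) with hl
  set δ : Fin d ⊕ Fin (min (m - d) (n - d) + 1) → ℕ :=
    Sum.elim (fun i => (i : ℕ)) (fun j => min m n - j) with hδ
  have hex : ∀ q, ∃ w ∈ homogeneous X Y u (δ q),
      ((X + Y) ^ (l q + 1)) w = 0 ∧ ((X + Y) ^ (l q)) w ≠ 0 := by
    rintro (i | j)
    · have hi := i.2
      refine ⟨(X ^ (i : ℕ)) u, monomial_mem X Y u (t := 0) (by simp [hδ]), ?_,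
        h.add_pow_apply_monomial_ne_zero (p := p) (by omega) (by omega) (by omega)⟩
      simp only [hl, Sum.elim_inl]
      rw [Nat.sub_add_cancel (by omega), hp, LinearMap.zero_apply]
    · have hj := j.2
      simp only [hl, hδ, Sum.elim_inr]
      exact h.exists_jordan_vector (p := p) (by omega) (by omega) (by omega) (by omega) (by omega)
        (by omega)
  choose w hw hw0 hw1 using hex
  refine ⟨w, .of_finrank hw0 (h.linearIndependent_of_homogeneous (δ := fun q => δ q + l q) ?_
    (fun j => h.add_pow_apply_mem (hw j) _) hw1) ?_⟩
  · rintro (a | a) (b | b) hab <;> have ha := a.2 <;> have hb := b.2 <;>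
      simp only [hl, hδ, Sum.elim_inl, Sum.elim_inr] at hab
    · exact congrArg _ (Fin.ext (by omega))
    · omega
    · omega
    · exact congrArg _ (Fin.ext (by omega))
  · rw [h.finrank_eq, Fintype.sum_sum_type]
    simp only [hl, Sum.elim_inl, Sum.elim_inr]
    rw [sum_jordan_lengths]
    obtain ⟨a, rfl⟩ := Nat.exists_eq_add_of_le hdm
    obtain ⟨b, rfl⟩ := Nat.exists_eq_add_of_le hdn
    simp only [Nat.add_sub_cancel_left, Finset.sum_const, Finset.card_univ, Fintype.card_fin,
      smul_eq_mul]
    rw [Nat.sub_add_cancel (by omega), show p = a + b + d + 2 by omega]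
    ring

end IsBoxSystem

section Indecomposable

open Module

variable {k W : Type*} [Field k] [AddCommGroup W] [Module k W]

/-- Let `N ^ l ≠ 0 = N ^ (l + 1)`. If the space admits no nontrivial decomposition into
`N`-stable subspaces, then it is a single Jordan block of size `l + 1`. -/
lemma finrank_eq_of_indecomposable [FiniteDimensional k W] {N : Module.End k W} {l : ℕ}
    (hN : N ^ (l + 1) = 0) {v : W} (hv : (N ^ l) v ≠ 0)
    (hind : ∀ U U' : Submodule k W, (∀ x ∈ U, N x ∈ U) → (∀ x ∈ U', N x ∈ U') →
      IsCompl U U' → U = ⊥ ∨ U' = ⊥) : finrank k W = l + 1 := by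
  classical
  obtain ⟨φ, hφ⟩ : ∃ φ : Dual k W, φ ((N ^ l) v) ≠ 0 := by
    by_contra! hcon
    exact hv ((forall_dual_apply_eq_zero_iff k _).1 hcon)
  let A : (Fin (l + 1) → k) →ₗ[k] W := Fintype.linearCombination k fun s => (N ^ (s : ℕ)) v
  let B : W →ₗ[k] (Fin (l + 1) → k) := LinearMap.pi fun t => φ ∘ₗ (N ^ (t : ℕ))
  have hBA : Function.Injective (B ∘ₗ A) := by
    rw [← LinearMap.ker_eq_bot, LinearMap.ker_eq_bot']
    intro c hc
    by_contra hne
    obtain ⟨s₁, hs₁⟩ := Function.ne_iff.1 hne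
    obtain ⟨s₀, hs₀, hmin⟩ := Finset.exists_min_image
      (Finset.univ.filter fun s : Fin (l + 1) => c s ≠ 0) (fun s => (s : ℕ))
      ⟨s₁, by simpa using hs₁⟩
    simp only [Finset.mem_filter, Finset.mem_univ, true_and] at hs₀ hmin
    have h1 := s₀.2
    have hsum := congrFun hc ⟨l - s₀, by omega⟩
    simp only [A, B, LinearMap.comp_apply, LinearMap.pi_apply, Fintype.linearCombination_apply,
      map_sum, map_smul, ← Module.End.mul_apply, ← pow_add, Pi.zero_apply, smul_eq_mul] at hsum
    rw [Finset.sum_eq_single s₀ _ (by simp), Nat.sub_add_cancel (by omega)] at hsum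
    · exact mul_ne_zero hs₀ hφ hsum
    · intro s _ hs
      by_cases hcs : c s = 0
      · rw [hcs, zero_mul]
      · have h2 := hmin s hcs
        have h3 : (s : ℕ) ≠ s₀ := fun h' => hs (Fin.ext h')
        rw [pow_apply_eq_zero_of_le (a := l + 1) (by rw [hN]; rfl) (by omega), map_zero, mul_zero]
  have hBA' : Function.Surjective (B ∘ₗ A) := LinearMap.injective_iff_surjective.1 hBA
  have hcompl : IsCompl (LinearMap.range A) (LinearMap.ker B) := by
    constructor
    · rw [Submodule.disjoint_def]
      rintro _ ⟨c, rfl⟩ hc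
      have : c = 0 := hBA (by simpa using hc)
      rw [this, map_zero]
    · rw [codisjoint_iff, eq_top_iff]
      intro x _
      obtain ⟨c, hc⟩ := hBA' (B x)
      refine Submodule.mem_sup.2 ⟨A c, ⟨c, rfl⟩, x - A c, ?_, add_sub_cancel _ _⟩
      rw [LinearMap.mem_ker, map_sub, sub_eq_zero]
      exact hc.symm
  have hAmem : ∀ s, (N ^ s) v ∈ LinearMap.range A := by
    intro s
    by_cases hs : s < l + 1
    · exact ⟨Pi.single ⟨s, hs⟩ 1, by simp [A, Fintype.linearCombination_apply_single]⟩
    · rw [pow_apply_eq_zero_of_le (a := l + 1) (by rw [hN]; rfl) (by omega)]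
      exact zero_mem _
  have hA : ∀ x ∈ LinearMap.range A, N x ∈ LinearMap.range A := by
    rintro _ ⟨c, rfl⟩
    simp only [A, Fintype.linearCombination_apply, map_sum, map_smul]
    refine sum_mem fun s _ => Submodule.smul_mem _ _ ?_
    rw [← Module.End.mul_apply, ← pow_succ']
    exact hAmem _
  have hB : ∀ x ∈ LinearMap.ker B, N x ∈ LinearMap.ker B := by
    intro x hx
    ext t
    simp only [B, LinearMap.pi_apply, LinearMap.comp_apply, Pi.zero_apply, ← Module.End.mul_apply,
      ← pow_succ]
    by_cases ht : (t : ℕ) + 1 < l + 1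
    · exact congrFun hx ⟨t + 1, ht⟩
    · rw [pow_apply_eq_zero_of_le (a := l + 1) (by rw [hN]; rfl) (by omega), map_zero]
  have hBinj : LinearMap.ker B = ⊥ := by
    refine (hind _ _ hA hB hcompl).resolve_left fun h0 => hv ?_
    have := hAmem l
    rwa [h0, Submodule.mem_bot] at this
  have h1 := LinearMap.finrank_le_finrank_of_injective (LinearMap.ker_eq_bot.1 hBinj)
  have h2 := LinearMap.finrank_le_finrank_of_injective
    (Function.Injective.of_comp (f := B) (g := A) hBA)
  rw [finrank_fin_fun] at h1 h2
  omega

lemma exists_pow_apply_ne_zero_of_indecomposable [FiniteDimensional k W] {N : Module.End k W}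
    (hN : IsNilpotent N) {i : ℕ} (hdim : finrank k W = i + 1)
    (hind : ∀ U U' : Submodule k W, (∀ x ∈ U, N x ∈ U) → (∀ x ∈ U', N x ∈ U') →
      IsCompl U U' → U = ⊥ ∨ U' = ⊥) : N ^ (i + 1) = 0 ∧ ∃ v, (N ^ i) v ≠ 0 := by
  have : Nontrivial W := Module.nontrivial_of_finrank_pos (R := k) (by omega)
  obtain ⟨l, hl⟩ := Nat.exists_eq_succ_of_ne_zero (pos_nilpotencyClass_iff.2 hN).ne'
  have h0 : N ^ (l + 1) = 0 := by rw [← Nat.succ_eq_add_one, ← hl, pow_nilpotencyClass hN]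
  have h1 : N ^ l ≠ 0 := by simpa [hl] using pow_pred_nilpotencyClass hN
  obtain ⟨v, hv⟩ : ∃ v, (N ^ l) v ≠ 0 := by
    by_contra! hcon
    exact h1 (LinearMap.ext hcon)
  have := finrank_eq_of_indecomposable h0 hv hind
  obtain rfl : i = l := by omega
  exact ⟨h0, v, hv⟩

end Indecomposable

section CyclicRep

variable {k : Type} [Field k] {p : ℕ}

/-- The operator `σ - 1` for the standard generator `σ` of `ℤ/pℤ`. -/
def unipotentPart (W : Rep.{0} k (Multiplicative (ZMod p))) : Module.End k W.V :=
  W.ρ (Multiplicative.ofAdd 1) - 1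

lemma apply_generator (W : Rep.{0} k (Multiplicative (ZMod p))) :
    W.ρ (Multiplicative.ofAdd 1) = unipotentPart W + 1 := (sub_add_cancel _ _).symm

lemma exists_eq_generator_pow [NeZero p] (g : Multiplicative (ZMod p)) :
    ∃ j : ℕ, g = Multiplicative.ofAdd 1 ^ j :=
  ⟨(Multiplicative.toAdd g).val, by
    rw [← ofAdd_nsmul, nsmul_one, ZMod.natCast_rightInverse, ofAdd_toAdd]⟩

lemma unipotentPart_pow [Fact p.Prime] [CharP k p] (W : Rep.{0} k (Multiplicative (ZMod p))) :
    unipotentPart W ^ p = 0 := by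
  have h := congrArg (Polynomial.aeval (W.ρ (Multiplicative.ofAdd 1)))
    (sub_pow_char (Polynomial.X : Polynomial k) 1 (p := p))
  have hσ : (Multiplicative.ofAdd 1 : Multiplicative (ZMod p)) ^ p = 1 := by
    rw [← ofAdd_nsmul, nsmul_one, CharP.cast_eq_zero, ofAdd_zero]
  simpa [← map_pow W.ρ, hσ, unipotentPart] using h

lemma hom_unipotentPart_pow {W W' : Rep.{0} k (Multiplicative (ZMod p))} (f : W ⟶ W') (r : ℕ)
    (x : W.V) : f.hom ((unipotentPart W ^ r) x) = (unipotentPart W' ^ r) (f.hom x) := by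
  induction r generalizing x with
  | zero => rfl
  | succ r ih =>
    rw [pow_succ, pow_succ, Module.End.mul_apply, Module.End.mul_apply, ih]
    simp [unipotentPart, Rep.hom_comm_apply]

lemma apply_mem_of_unipotentPart_mem [NeZero p] (W : Rep.{0} k (Multiplicative (ZMod p)))
    {U : Submodule k W.V} (hU : ∀ x ∈ U, unipotentPart W x ∈ U) : IsSubrep W.ρ U := by
  intro g v hv
  obtain ⟨j, rfl⟩ := exists_eq_generator_pow g
  rw [map_pow, apply_generator]
  induction j with
  | zero => exact hv
  | succ j ih =>
    rw [pow_succ', Module.End.mul_apply]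
    exact add_mem (hU _ ih) ih

lemma nonempty_iso_of_isJordanSystem [NeZero p] {W W' : Rep.{0} k (Multiplicative (ZMod p))}
    {ι : Type*} [Fintype ι] {l : ι → ℕ} {w : ι → W.V} {w' : ι → W'.V}
    (h : IsJordanSystem (unipotentPart W) l w) (h' : IsJordanSystem (unipotentPart W') l w') :
    Nonempty (W ≅ W') := by
  obtain ⟨e, he⟩ := h.exists_equiv h'
  have hg : ∀ g : Multiplicative (ZMod p), e.toLinearMap ∘ₗ W.ρ g = W'.ρ g ∘ₗ e.toLinearMap := by
    intro g
    obtain ⟨j, rfl⟩ := exists_eq_generator_pow g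
    ext x
    simp only [map_pow, LinearMap.comp_apply, LinearEquiv.coe_coe, apply_generator]
    induction j generalizing x with
    | zero => rfl
    | succ j ih =>
      rw [pow_succ, pow_succ, Module.End.mul_apply, Module.End.mul_apply, ih]
      simp [he]
  exact ⟨Rep.mkIso (ρ := W.ρ) (σ := W'.ρ) { e with isIntertwining' := hg }⟩

lemma exists_top_vector [Fact p.Prime] [CharP k p] {V : Rep.{0} k (Multiplicative (ZMod p))}
    (hV : RepIndecomposable V) {i : ℕ} (hdim : Module.finrank k V.V = i + 1) :
    unipotentPart V ^ (i + 1) = 0 ∧ ∃ v, (unipotentPart V ^ i) v ≠ 0 := by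
  have : FiniteDimensional k V.V := Module.finite_of_finrank_pos (by omega)
  exact exists_pow_apply_ne_zero_of_indecomposable ⟨p, unipotentPart_pow V⟩ hdim
    fun U U' hU hU' => hV.2 U U' (apply_mem_of_unipotentPart_mem V hU)
      (apply_mem_of_unipotentPart_mem V hU')

lemma exists_isJordanSystem_unit [Fact p.Prime] [CharP k p] {V : Rep.{0} k (Multiplicative (ZMod p))}
    (hV : RepIndecomposable V) {i : ℕ} (hdim : Module.finrank k V.V = i + 1) :
    ∃ v, IsJordanSystem (unipotentPart V) (fun _ : Unit => i) (fun _ => v) := by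
  have : FiniteDimensional k V.V := Module.finite_of_finrank_pos (by omega)
  obtain ⟨h0, v, hv⟩ := exists_top_vector hV hdim
  exact ⟨v, .of_finrank (fun _ => by rw [h0]; rfl)
    (by simpa [linearIndependent_unique_iff] using hv) (by simp [hdim])⟩

lemma apply_mem_of_isJordanSystem {W W' : Rep.{0} k (Multiplicative (ZMod p))} {ι : Type*}
    {l : ι → ℕ} {w : ι → W.V} (h : IsJordanSystem (unipotentPart W) l w) (f : W ⟶ W')
    {U : Submodule k W'.V} (hU : ∀ i, ∀ s < l i + 1, (unipotentPart W' ^ s) (f.hom (w i)) ∈ U)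
    (x : W.V) : f.hom x ∈ U := by
  refine (h.span_eq_top.trans (Submodule.span_le (p := U.comap f.hom.toLinearMap).2 ?_))
    (Submodule.mem_top (x := x))
  rintro _ ⟨q, rfl⟩
  have := hU q.1 q.2 q.2.2
  rwa [← hom_unipotentPart_pow] at this

lemma isJordanSystem_biproduct {ι : Type} [Fintype ι]
    {F : ι → Rep.{0} k (Multiplicative (ZMod p))} {l : ι → ℕ} {v : ∀ i, (F i).V}
    (h : ∀ i, IsJordanSystem (unipotentPart (F i)) (fun _ : Unit => l i) (fun _ => v i)) :
    IsJordanSystem (unipotentPart (⨁ F)) l (fun i => (biproduct.ι F i).hom (v i)) where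
  pow_succ_apply i := by
    rw [← hom_unipotentPart_pow, (h i).pow_succ_apply (), map_zero]
  linearIndependent_top := by
    classical
    rw [Fintype.linearIndependent_iff]
    intro c hc i
    have hπ := congrArg (biproduct.π F i).hom hc
    simp only [map_sum, map_smul, map_zero, ← hom_unipotentPart_pow] at hπ
    rw [Finset.sum_eq_single i _ (by simp)] at hπ
    · have hne := (h i).linearIndependent_top.ne_zero ()
      have hid := congrArg (fun f => f.hom ((unipotentPart (F i) ^ l i) (v i)))
        (biproduct.ι_π_self F i)
      simp only [Rep.hom_comp, Rep.hom_id] at hid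
      change (biproduct.π F i).hom ((biproduct.ι F i).hom _) = (unipotentPart (F i) ^ l i) (v i)
        at hid
      rw [hid] at hπ
      exact (smul_eq_zero.1 hπ).resolve_right hne
    · intro j _ hj
      have h0 := congrArg (fun f => f.hom ((unipotentPart (F j) ^ l j) (v j)))
        (biproduct.ι_π_ne F hj)
      change (biproduct.π F i).hom ((biproduct.ι F j).hom _) = 0 at h0
      rw [h0, smul_zero]
  span_eq_top := by
    intro x _
    have htot := congrArg (fun f => f.hom x) (biproduct.total (f := F))
    simp only [Rep.sum_hom, Rep.hom_comp] at htot
    rw [show x = _ from htot.symm]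
    simp only [Representation.IntertwiningMap.sum_apply]
    refine sum_mem fun i _ => apply_mem_of_isJordanSystem (h i) _ ?_ _
    exact fun _ s hs => Submodule.subset_span ⟨⟨i, ⟨s, hs⟩⟩, rfl⟩

lemma isJordanSystem_biprod {ι κ : Type} [Fintype ι] [Fintype κ]
    {A B : Rep.{0} k (Multiplicative (ZMod p))} {l : ι → ℕ} {w : ι → A.V} {l' : κ → ℕ} {w' : κ → B.V}
    (h : IsJordanSystem (unipotentPart A) l w) (h' : IsJordanSystem (unipotentPart B) l' w') :
    IsJordanSystem (unipotentPart (A ⊞ B)) (Sum.elim l l')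
      (Sum.elim (fun i => (biprod.inl : A ⟶ A ⊞ B).hom (w i))
        (fun j => (biprod.inr : B ⟶ A ⊞ B).hom (w' j))) where
  pow_succ_apply := by
    rintro (i | j)
    · simp only [Sum.elim_inl]
      rw [← hom_unipotentPart_pow, h.pow_succ_apply, map_zero]
    · simp only [Sum.elim_inr]
      rw [← hom_unipotentPart_pow, h'.pow_succ_apply, map_zero]
  linearIndependent_top := by
    rw [Fintype.linearIndependent_iff]
    intro c hc
    simp only [Fintype.sum_sum_type, Sum.elim_inl, Sum.elim_inr, ← hom_unipotentPart_pow] at hc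
    have h1 : ∀ x, (biprod.fst : A ⊞ B ⟶ A).hom ((biprod.inl : A ⟶ A ⊞ B).hom x) = x :=
      fun x => congrArg (fun f : A ⟶ A => f.hom x) biprod.inl_fst
    have h2 : ∀ x, (biprod.fst : A ⊞ B ⟶ A).hom ((biprod.inr : B ⟶ A ⊞ B).hom x) = 0 :=
      fun x => congrArg (fun f : B ⟶ A => f.hom x) biprod.inr_fst
    have h3 : ∀ x, (biprod.snd : A ⊞ B ⟶ B).hom ((biprod.inl : A ⟶ A ⊞ B).hom x) = 0 :=
      fun x => congrArg (fun f : A ⟶ B => f.hom x) biprod.inl_snd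
    have h4 : ∀ x, (biprod.snd : A ⊞ B ⟶ B).hom ((biprod.inr : B ⟶ A ⊞ B).hom x) = x :=
      fun x => congrArg (fun f : B ⟶ B => f.hom x) biprod.inr_snd
    have hA := congrArg (biprod.fst : A ⊞ B ⟶ A).hom hc
    have hB := congrArg (biprod.snd : A ⊞ B ⟶ B).hom hc
    simp only [map_add, map_sum, map_smul, map_zero, h1, h2, h3, h4, smul_zero,
      Finset.sum_const_zero, add_zero, zero_add] at hA hB
    rintro (i | j)
    · exact Fintype.linearIndependent_iff.1 h.linearIndependent_top _ hA i
    · exact Fintype.linearIndependent_iff.1 h'.linearIndependent_top _ hB j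
  span_eq_top := by
    intro x _
    have htot : (biprod.inl : A ⟶ A ⊞ B).hom ((biprod.fst : A ⊞ B ⟶ A).hom x) +
        (biprod.inr : B ⟶ A ⊞ B).hom ((biprod.snd : A ⊞ B ⟶ B).hom x) = x :=
      congrArg (fun f : A ⊞ B ⟶ A ⊞ B => f.hom x) (biprod.total (X := A) (Y := B))
    rw [← htot]
    refine add_mem (apply_mem_of_isJordanSystem h _ ?_ _) (apply_mem_of_isJordanSystem h' _ ?_ _)
    · exact fun i s hs => Submodule.subset_span ⟨⟨Sum.inl i, ⟨s, hs⟩⟩, rfl⟩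
    · exact fun i s hs => Submodule.subset_span ⟨⟨Sum.inr i, ⟨s, hs⟩⟩, rfl⟩

lemma unipotentPart_tensor (A B : Rep.{0} k (Multiplicative (ZMod p))) :
    unipotentPart (A ⊗ B) =
      TensorProduct.map (unipotentPart A) (B.ρ (Multiplicative.ofAdd 1)) +
        TensorProduct.map 1 (unipotentPart B) := by
  change TensorProduct.map (A.ρ _) (B.ρ _) - 1 = _
  rw [apply_generator, apply_generator, TensorProduct.map_add_left, add_sub_assoc]
  congr 1
  rw [TensorProduct.map_add_right, add_sub_assoc, ← TensorProduct.map_one, sub_self, add_zero]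

lemma tmul_ne_zero_of_ne_zero {V V' : Type*} [AddCommGroup V] [Module k V] [AddCommGroup V']
    [Module k V'] {v : V} {v' : V'} (hv : v ≠ 0) (hv' : v' ≠ 0) : v ⊗ₜ[k] v' ≠ 0 := by
  intro h
  obtain ⟨φ, hφ⟩ : ∃ φ : Module.Dual k V, φ v ≠ 0 := by
    by_contra! hcon
    exact hv ((Module.forall_dual_apply_eq_zero_iff k _).1 hcon)
  obtain ⟨ψ, hψ⟩ : ∃ ψ : Module.Dual k V', ψ v' ≠ 0 := by
    by_contra! hcon
    exact hv' ((Module.forall_dual_apply_eq_zero_iff k _).1 hcon)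
  have := congrArg (TensorProduct.lid k k ∘ TensorProduct.map φ ψ) h
  simp [hφ, hψ] at this

/-- On `A ⊗ B` we have `σ - 1 = X + Y` with `X = (σ - 1) ⊗ σ` and `Y = 1 ⊗ (σ - 1)`, and
`X`, `Y` form a box system when `A` and `B` are indecomposable. -/
lemma exists_isBoxSystem [Fact p.Prime] [CharP k p] {A B : Rep.{0} k (Multiplicative (ZMod p))}
    (hA : RepIndecomposable A) (hB : RepIndecomposable B) {m n : ℕ}
    (hm : Module.finrank k A.V = m + 1) (hn : Module.finrank k B.V = n + 1) :
    ∃ (X Y : Module.End k (A ⊗ B : Rep.{0} k (Multiplicative (ZMod p))).V)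
      (u : (A ⊗ B : Rep.{0} k (Multiplicative (ZMod p))).V),
      unipotentPart (A ⊗ B) = X + Y ∧ IsBoxSystem X Y u m n := by
  obtain ⟨hA0, v, hv⟩ := exists_top_vector hA hm
  obtain ⟨hB0, v', hv'⟩ := exists_top_vector hB hn
  refine ⟨_, _, v ⊗ₜ v', unipotentPart_tensor A B, ?_⟩
  have hpow : ∀ r : ℕ, ((B.ρ (Multiplicative.ofAdd 1)) ^ r) ((unipotentPart B ^ n) v') =
      (unipotentPart B ^ n) v' := by
    intro r
    induction r with
    | zero => rfl
    | succ r ih =>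
      rw [pow_succ, Module.End.mul_apply, apply_generator, LinearMap.add_apply,
        ← Module.End.mul_apply, ← pow_succ', hB0, LinearMap.zero_apply, zero_add,
        ← apply_generator]
      exact ih
  constructor
  · change TensorProduct.map _ _ * TensorProduct.map _ _ =
      TensorProduct.map _ _ * TensorProduct.map _ _
    rw [← TensorProduct.map_mul, ← TensorProduct.map_mul, apply_generator, one_mul, mul_one,
      add_mul, mul_add, one_mul, mul_one]
  · rw [TensorProduct.map_pow, hA0, TensorProduct.map_zero_left]
  · rw [TensorProduct.map_pow, hB0, TensorProduct.map_zero_right]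
  · rw [TensorProduct.map_pow, TensorProduct.map_pow, one_pow, TensorProduct.map_tmul,
      TensorProduct.map_tmul, hpow]
    exact tmul_ne_zero_of_ne_zero hv hv'
  · exact (Module.finrank_tensorProduct (R := k) (S := k) (M := A.V) (M' := B.V)).trans
      (by rw [hm, hn])

lemma exists_isJordanSystem_tensor [Fact p.Prime] [CharP k p]
    {A B : Rep.{0} k (Multiplicative (ZMod p))}
    (hA : RepIndecomposable A) (hB : RepIndecomposable B) {m n : ℕ}
    (hm : Module.finrank k A.V = m + 1) (hn : Module.finrank k B.V = n + 1) (hmn : m + n < p) :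
    ∃ w, IsJordanSystem (unipotentPart (A ⊗ B))
      (fun j : Fin (min m n + 1) => max m n - min m n + 2 * (j : ℕ)) w := by
  obtain ⟨X, Y, u, hXY, h⟩ := exists_isBoxSystem hA hB hm hn
  rw [hXY]
  exact h.exists_isJordanSystem_of_add_lt hmn

lemma exists_isJordanSystem_biproduct [Fact p.Prime] [CharP k p] {ι : Type} [Fintype ι]
    {F : ι → Rep.{0} k (Multiplicative (ZMod p))} {l : ι → ℕ}
    (hF : ∀ i, RepIndecomposable (F i)) (hl : ∀ i, Module.finrank k (F i).V = l i + 1) :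
    ∃ w, IsJordanSystem (unipotentPart (⨁ F)) l w := by
  choose v hv using fun i => exists_isJordanSystem_unit (hF i) (hl i)
  exact ⟨_, isJordanSystem_biproduct hv⟩

end CyclicRep

/-- **Proposition (modular Clebsch–Gordan).** For `G = ℤ/pℤ` (`p` an odd prime) over a
field of characteristic `p`, with `V_i` the indecomposable representation of dimension
`i + 1` and `0 ≤ m, n ≤ p − 1`:
if `m + n ≤ p − 1` then `V_m ⊗ V_n ≅ V_{|m−n|} ⊕ V_{|m−n|+2} ⊕ ⋯ ⊕ V_{m+n}`;
if `m + n = p − 2 + d` with `d ≥ 1` (so that `d ≤ m` and `d ≤ n` whenever the indices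
`m − d`, `n − d` are meaningful) then `V_m ⊗ V_n ≅ d·V_{p−1} ⊕ (V_{m−d} ⊗ V_{n−d})`. -/
theorem modular_clebsch_gordan {k : Type} [Field k]
    (p : ℕ) [Fact p.Prime] (hodd : Odd p) [CharP k p]
    (Vr : ℕ → Rep k (Multiplicative (ZMod p)))
    (hind : ∀ i ≤ p - 1, RepIndecomposable (Vr i))
    (hdim : ∀ i ≤ p - 1, Module.finrank k (Vr i).V = i + 1)
    (m n : ℕ) (hm : m ≤ p - 1) (hn : n ≤ p - 1) :
    (m + n ≤ p - 1 →
      Nonempty ((Vr m ⊗ Vr n : Rep k (Multiplicative (ZMod p))) ≅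
        ⨁ fun j : Fin (min m n + 1) => Vr (max m n - min m n + 2 * (j : ℕ)))) ∧
      (∀ d : ℕ, 1 ≤ d → d ≤ m → d ≤ n → m + n = p - 2 + d →
        Nonempty ((Vr m ⊗ Vr n : Rep k (Multiplicative (ZMod p))) ≅
          (⨁ fun _ : Fin d => Vr (p - 1)) ⊞
            (Vr (m - d) ⊗ Vr (n - d) : Rep k (Multiplicative (ZMod p))))) := by
  have hp := (Fact.out : p.Prime).two_le
  constructor
  · intro hmn
    obtain ⟨w, hw⟩ := exists_isJordanSystem_tensor (hind m hm) (hind n hn) (hdim m hm) (hdim n hn)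
      (by omega)
    obtain ⟨w', hw'⟩ := exists_isJordanSystem_biproduct
      (F := fun j : Fin (min m n + 1) => Vr (max m n - min m n + 2 * (j : ℕ)))
      (fun j => hind _ (by omega)) (fun j => hdim _ (by omega))
    exact nonempty_iso_of_isJordanSystem hw hw'
  · intro d hd hdm hdn hmn
    obtain ⟨X, Y, u, hXY, h⟩ := exists_isBoxSystem (hind m hm) (hind n hn) (hdim m hm) (hdim n hn)
    obtain ⟨w, hw⟩ := h.exists_isJordanSystem_of_le_add (p := p) hdm hdn hd (by omega)
      (by rw [← hXY, unipotentPart_pow])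
    rw [← hXY] at hw
    obtain ⟨w₁, hw₁⟩ := exists_isJordanSystem_biproduct (F := fun _ : Fin d => Vr (p - 1))
      (fun _ => hind _ le_rfl) (fun _ => hdim _ le_rfl)
    obtain ⟨w₂, hw₂⟩ := exists_isJordanSystem_tensor (hind (m - d) (by omega))
      (hind (n - d) (by omega)) (hdim _ (by omega)) (hdim _ (by omega)) (by omega)
    exact nonempty_iso_of_isJordanSystem hw (isJordanSystem_biprod hw₁ hw₂)
end
end

section
/- Let G be a finite group and V a faithful finite-dimensional complex representation of G, and let 𝟙 denote the trivial one-dimensional representation. Then there exists an integer N such that for every k ≥ N, the representation (𝟙 ⊕ V)^{⊗k} contains the regular representation of G as a direct summand. -/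
open CategoryTheory MonoidalCategory Limits

noncomputable section

universe u

/-- `A` is a direct summand of `B` in `Rep k G`. -/
def IsDirectSummand {k G : Type u} [Field k] [Monoid G] (A B : Rep k G) : Prop :=
  ∃ W : Rep k G, Nonempty (B ≅ A ⊞ W)

/-- The `n`-th tensor power of a representation, in the category `Rep k G`. -/
def tpow {k G : Type u} [Field k] [Monoid G] (V : Rep k G) : ℕ → Rep k G
  | 0 => 𝟙_ (Rep k G)
  | n + 1 => tpow V n ⊗ V

theorem isDirectSummand_of_isSplitMono {k G : Type u} [Field k] [Monoid G] {A B : Rep k G}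
    (f : A ⟶ B) [IsSplitMono f] : IsDirectSummand A B :=
  ⟨cokernel f, ⟨BinaryBiproduct.isBilimit A (cokernel f) |>.isLimit.conePointUniqueUpToIso
    (isBilimitBinaryBiconeOfIsSplitMonoOfCokernel (cokernelIsCokernel f)).isLimit |>.symm⟩⟩

/-- The `G`-equivariant map `A ⟶ k[G]` sending `x` to `∑ g, F (g⁻¹ x) g`. -/
def homLeftRegular {k G : Type u} [Field k] [Group G] [Fintype G] (A : Rep k G)
    (F : Module.Dual k A.V) : A ⟶ Rep.leftRegular k G :=
  Rep.ofHom ⟨∑ g : G, MonoidAlgebra.lsingle g ∘ₗ F ∘ₗ A.ρ g⁻¹, fun h => by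
    ext x : 1
    simp only [LinearMap.comp_apply, LinearMap.sum_apply, map_sum, MonoidAlgebra.lsingle_apply,
      Representation.ofMulAction_single, smul_eq_mul]
    refine Fintype.sum_equiv (Equiv.mulLeft h⁻¹) _ _ fun g => ?_
    simp [← Module.End.mul_apply, ← map_mul]⟩

theorem homLeftRegular_apply {k G : Type u} [Field k] [Group G] [Fintype G] (A : Rep k G)
    (F : Module.Dual k A.V) (x : A.V) :
    (homLeftRegular A F).hom x = ∑ g : G, MonoidAlgebra.single g (F (A.ρ g⁻¹ x)) := by
  change (∑ g : G, MonoidAlgebra.lsingle g ∘ₗ F ∘ₗ A.ρ g⁻¹) x = _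
  simp

/-- If some linear form vanishes at all nontrivial translates of `x` but not at `x`, then `x`
generates a copy of the regular representation that splits off. -/
theorem isDirectSummand_leftRegular {k G : Type u} [Field k] [Group G] [Finite G] (A : Rep k G)
    (x : A.V) (F : Module.Dual k A.V) (hx : F x ≠ 0) (hF : ∀ g : G, g ≠ 1 → F (A.ρ g x) = 0) :
    IsDirectSummand (Rep.leftRegular k G) A := by
  classical
  have := Fintype.ofFinite G
  have hsplit : Rep.leftRegularHom A x ≫ homLeftRegular A ((F x)⁻¹ • F) = 𝟙 _ := by
    ext h : 4
    have hsum : (homLeftRegular A ((F x)⁻¹ • F)).hom (A.ρ h x) = MonoidAlgebra.single h 1 := by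
      rw [homLeftRegular_apply, Finset.sum_eq_single h]
      · simp [hx, ← Module.End.mul_apply, ← map_mul]
      · intro g _ hg
        simp [← Module.End.mul_apply, ← map_mul, hF (g⁻¹ * h) (by simpa [inv_mul_eq_one] using hg)]
      · simp
    simpa using hsum
  have : IsSplitMono (Rep.leftRegularHom A x) := ⟨⟨⟨_, hsplit⟩⟩⟩
  exact isDirectSummand_of_isSplitMono (Rep.leftRegularHom A x)

/-- The pure tensor `x ⊗ ⋯ ⊗ x` in the `n`-th tensor power. -/
def tpowVec {k G : Type u} [Field k] [Monoid G] (W : Rep k G) (x : W.V) :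
    (n : ℕ) → (tpow W n).V
  | 0 => (1 : k)
  | n + 1 => TensorProduct.tmul k (tpowVec W x n) x

theorem tpow_ρ_tpowVec {k G : Type u} [Field k] [Monoid G] (W : Rep k G) (x : W.V) (g : G)
    (n : ℕ) : (tpow W n).ρ g (tpowVec W x n) = tpowVec W (W.ρ g x) n := by
  induction n with
  | zero => rfl
  | succ n ih => exact congrArg (TensorProduct.tmul k · (W.ρ g x)) ih

/-- A linear form on a tensor power whose value on pure powers is a product of linear forms. -/
theorem exists_dual_tpowVec_mul {k G : Type u} [Field k] [Monoid G] (W : Rep k G) (n : ℕ)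
    (F : Module.Dual k (tpow W n).V) (φ : Module.Dual k W.V) :
    ∃ F' : Module.Dual k (tpow W (n + 1)).V,
      ∀ x, F' (tpowVec W x (n + 1)) = F (tpowVec W x n) * φ x :=
  ⟨LinearMap.mul' k k ∘ₗ TensorProduct.map F φ, fun _ => rfl⟩

theorem exists_dual_tpowVec_separating {k G : Type u} [Field k] [Monoid G] (W : Rep k G)
    {x : W.V} (hx : x ≠ 0) (n : ℕ) (s : Finset W.V)
    (hs : ∀ y ∈ s, ∃ φ : Module.Dual k W.V, φ x ≠ 0 ∧ φ y = 0) (hn : s.card ≤ n) :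
    ∃ F : Module.Dual k (tpow W n).V,
      F (tpowVec W x n) ≠ 0 ∧ ∀ y ∈ s, F (tpowVec W y n) = 0 := by
  classical
  induction n generalizing s with
  | zero =>
    obtain rfl : s = ∅ := by simpa using hn
    exact ⟨(LinearMap.id : k →ₗ[k] k), one_ne_zero (α := k), by simp⟩
  | succ n ih =>
    obtain rfl | ⟨y, hy⟩ := s.eq_empty_or_nonempty
    · obtain ⟨F, hF, -⟩ := ih ∅ (by simp) (by simp)
      obtain ⟨t, ht⟩ := Module.Projective.exists_dual_ne_zero k hx
      obtain ⟨F', hF'⟩ := exists_dual_tpowVec_mul W n F t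
      exact ⟨F', by simp [hF', hF, ht], by simp⟩
    · obtain ⟨F, hF, hF0⟩ := ih (s.erase y) (fun z hz => hs z (Finset.mem_of_mem_erase hz))
        (by rw [Finset.card_erase_of_mem hy]; omega)
      obtain ⟨φ, hφ, hφ0⟩ := hs y hy
      obtain ⟨F', hF'⟩ := exists_dual_tpowVec_mul W n F φ
      refine ⟨F', by simp [hF', hF, hφ], fun z hz => ?_⟩
      obtain rfl | hzy := eq_or_ne z y
      · simp [hF', hφ0]
      · simp [hF', hF0 z (Finset.mem_erase.2 ⟨hzy, hz⟩)]

/-- A faithful representation of a finite group over an infinite field has a vector with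
trivial stabilizer. -/
theorem exists_forall_ρ_apply_ne {k G V : Type*} [Field k] [Infinite k] [Group G] [Finite G]
    [AddCommGroup V] [Module k V] (ρ : Representation k G V) (hρ : Function.Injective ρ) :
    ∃ v : V, ∀ g : G, g ≠ 1 → ρ g v ≠ v := by
  by_contra! h
  have hcover : ⋃ g : {g : G // g ≠ 1}, (LinearMap.eqLocus (ρ g) LinearMap.id : Set V) =
      Set.univ := by
    refine Set.eq_univ_of_forall fun v => ?_
    obtain ⟨g, hg, hgv⟩ := h v
    exact Set.mem_iUnion.2 ⟨⟨g, hg⟩, hgv⟩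
  obtain ⟨⟨g, hg⟩, htop⟩ := Subspace.exists_eq_top_of_iUnion_eq_univ hcover
  refine hg (hρ ?_)
  rw [map_one]
  exact LinearMap.eqLocus_eq_top.1 htop

/-- If distinct vectors have the same nonzero value under a linear form, then some linear form
vanishes at the second but not at the first. -/
theorem exists_dual_ne_zero_and_eq_zero {k W : Type*} [Field k] [AddCommGroup W] [Module k W]
    {x y : W} (t : Module.Dual k W) (hx : t x ≠ 0) (hxy : t x = t y) (hne : x ≠ y) :
    ∃ φ : Module.Dual k W, φ x ≠ 0 ∧ φ y = 0 := by
  obtain ⟨ψ, hψ⟩ := Module.Projective.exists_dual_ne_zero k (sub_ne_zero.2 hne)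
  refine ⟨t y • ψ - ψ y • t, ?_, by simp [mul_comm]⟩
  have : (t y • ψ - ψ y • t) x = t x * ψ (x - y) := by
    simp [hxy]; ring
  rw [this]
  exact mul_ne_zero hx hψ

theorem exists_biprod_fst_snd_eq {k G : Type u} [Field k] [Monoid G] (A B : Rep k G)
    (a : A.V) (b : B.V) :
    ∃ x : (A ⊞ B).V,
      (biprod.fst : A ⊞ B ⟶ A).hom x = a ∧ (biprod.snd : A ⊞ B ⟶ B).hom x = b := by
  refine ⟨(biprod.inl : A ⟶ A ⊞ B).hom a + (biprod.inr : B ⟶ A ⊞ B).hom b, ?_, ?_⟩ <;>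
    simp [← Rep.comp_apply]

/-- **Lemma.** If `V` is a faithful finite-dimensional complex representation of a finite
group `G`, there is an `N` such that for every `j ≥ N` the tensor power `(𝟙 ⊕ V)^{⊗j}`
contains the regular representation of `G` as a direct summand. -/
theorem regular_rep_summand_of_faithful {G : Type} [Group G] [Finite G]
    (V : Rep ℂ G) (hfd : FiniteDimensional ℂ V.V)
    (hfaith : Function.Injective fun g : G => V.ρ g) :
    ∃ N : ℕ, ∀ j : ℕ, j ≥ N →
      IsDirectSummand (Rep.leftRegular ℂ G) (tpow ((𝟙_ (Rep ℂ G)) ⊞ V) j) := by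
  classical
  have := Fintype.ofFinite G
  obtain ⟨v, hv⟩ := exists_forall_ρ_apply_ne V.ρ hfaith
  set W : Rep ℂ G := 𝟙_ (Rep ℂ G) ⊞ V
  let t : Module.Dual ℂ W.V := (biprod.fst : W ⟶ 𝟙_ (Rep ℂ G)).hom.toLinearMap
  let p : W ⟶ V := biprod.snd
  obtain ⟨x, hx1, hx2⟩ : ∃ x : W.V, t x = (1 : ℂ) ∧ p.hom x = v :=
    exists_biprod_fst_snd_eq (𝟙_ (Rep ℂ G)) V (1 : ℂ) v
  have htx (g : G) : t (W.ρ g x) = 1 := by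
    rw [← hx1]
    exact Rep.hom_comm_apply (biprod.fst : W ⟶ 𝟙_ (Rep ℂ G)) g x
  have hne (g : G) (hg : g ≠ 1) : x ≠ W.ρ g x := fun h => hv g hg <| by
    rw [← hx2, ← Rep.hom_comm_apply, ← h]
  have hx0 : x ≠ 0 := by
    rintro rfl
    simp at hx1
  let s : Finset W.V := (Finset.univ.erase 1).image fun g : G => W.ρ g x
  refine ⟨s.card, fun j hj => ?_⟩
  obtain ⟨F, hF, hF0⟩ := exists_dual_tpowVec_separating W hx0 j s (fun y hy => by
    obtain ⟨g, hg, rfl⟩ := Finset.mem_image.1 hy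
    exact exists_dual_ne_zero_and_eq_zero t (by simp [hx1]) (by rw [hx1, htx])
      (hne g (Finset.ne_of_mem_erase hg))) hj
  refine isDirectSummand_leftRegular _ (tpowVec W x j) F hF fun g hg => ?_
  rw [tpow_ρ_tpowVec]
  exact hF0 _ (Finset.mem_image_of_mem _ (Finset.mem_erase.2 ⟨hg, Finset.mem_univ g⟩))
end
end
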